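/- arXiv:2511.20118 — 5 statements merged into one kernel-verified Lean document; each statement's English description precedes it below -/
import Mathlib

section
/- There exist a probability space (Ω, 𝓕, P) and a stochastic process B : ℝ≥0 → Ω → ℝ such that every path t ↦ B_t(ω) is continuous, and for every n ∈ ℕ and every t₁, …, tₙ ∈ ℝ≥0 the random vector (B_{t₁}, …, B_{tₙ}) has a multivariate Gaussian distribution with mean 0 and covariance matrix given by cov(B_{t_i}, B_{t_j}) = min(t_i, t_j). In other words, a Brownian motion exists. -/
open MeasureTheory ProbabilityTheory NNReal

/-- tent function -/
noncomputable def tentFn (x : ℝ) : ℝ := max 0 (1/2 - |x - 1/2|)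
/-- clamp to `[0,1]` -/
noncomputable def clampFn (x : ℝ) : ℝ := max 0 (min x 1)

lemma continuous_tentFn : Continuous tentFn := by unfold tentFn; fun_prop
lemma continuous_clampFn : Continuous clampFn := by unfold clampFn; fun_prop

lemma tentFn_of_nonpos {x : ℝ} (h : x ≤ 0) : tentFn x = 0 := by
  unfold tentFn; rw [abs_of_nonpos (by linarith)]; exact max_eq_left (by linarith)
lemma tentFn_of_one_le {x : ℝ} (h : 1 ≤ x) : tentFn x = 0 := by
  unfold tentFn; rw [abs_of_nonneg (by linarith)]; exact max_eq_left (by linarith)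
lemma tentFn_left {x : ℝ} (h : 0 ≤ x) (h' : x ≤ 1/2) : tentFn x = x := by
  unfold tentFn; rw [abs_of_nonpos (by linarith), max_eq_right (by linarith)]; ring
lemma tentFn_right {x : ℝ} (h : 1/2 ≤ x) (h' : x ≤ 1) : tentFn x = 1 - x := by
  unfold tentFn; rw [abs_of_nonneg (by linarith), max_eq_right (by linarith)]; ring
lemma tentFn_nonneg (x : ℝ) : 0 ≤ tentFn x := le_max_left _ _
lemma tentFn_le_one (x : ℝ) : tentFn x ≤ 1 := by
  unfold tentFn; apply max_le (by norm_num); linarith [abs_nonneg (x - 1/2)]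
lemma clampFn_of_nonpos {x : ℝ} (h : x ≤ 0) : clampFn x = 0 := by
  unfold clampFn; exact max_eq_left ((min_le_left _ _).trans h)
lemma clampFn_of_one_le {x : ℝ} (h : 1 ≤ x) : clampFn x = 1 := by
  unfold clampFn; rw [min_eq_right h]; norm_num
lemma clampFn_mid {x : ℝ} (h : 0 ≤ x) (h' : x ≤ 1) : clampFn x = x := by
  unfold clampFn; rw [min_eq_left h', max_eq_right h]
lemma clampFn_nonneg (x : ℝ) : 0 ≤ clampFn x := le_max_left _ _
lemma clampFn_le_one (x : ℝ) : clampFn x ≤ 1 := max_le (by norm_num) (min_le_right _ _)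

/-- Covariance (for `x ≤ y`) of the piecewise linear interpolation at integers. -/
noncomputable def covG (x y : ℝ) : ℝ := ⌊x⌋₊ + (x - ⌊x⌋₊) * clampFn (y - ⌊x⌋₊)

lemma covG_double {x y : ℝ} (hx : 0 ≤ x) (hxy : x ≤ y) :
    covG (2 * x) (2 * y) = 2 * (covG x y + tentFn (x - ⌊x⌋₊) * tentFn (y - ⌊x⌋₊)) := by
  have h1 := Nat.floor_le hx
  have h2 := Nat.lt_floor_add_one x
  unfold covG
  generalize ⌊x⌋₊ = m at *
  obtain ⟨u, rfl⟩ : ∃ u, x = m + u := ⟨x - m, by ring⟩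
  obtain ⟨v, rfl⟩ : ∃ v, y = m + v := ⟨y - m, by ring⟩
  simp only [add_sub_cancel_left]
  have hu : 0 ≤ u := by linarith
  have hu1 : u < 1 := by linarith
  have huv : u ≤ v := by linarith
  rcases lt_or_ge u (1/2) with h | h
  · have : ⌊2 * ((m:ℝ) + u)⌋₊ = 2 * m := by
      rw [Nat.floor_eq_iff (by positivity)]; push_cast; constructor <;> linarith
    rw [this, tentFn_left hu h.le]; push_cast
    rw [show 2 * ((m:ℝ) + v) - 2 * m = 2 * v by ring]
    rcases le_total v (1/2) with h' | h'
    · rw [tentFn_left (by linarith) h', clampFn_mid (by linarith) (by linarith),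
        clampFn_mid (by linarith) (by linarith)]; ring
    · rw [clampFn_of_one_le (by linarith)]
      rcases le_total v 1 with h'' | h''
      · rw [tentFn_right h' h'', clampFn_mid (by linarith) h'']; ring
      · rw [tentFn_of_one_le h'', clampFn_of_one_le h'']; ring
  · have : ⌊2 * ((m:ℝ) + u)⌋₊ = 2 * m + 1 := by
      rw [Nat.floor_eq_iff (by positivity)]; push_cast; constructor <;> linarith
    rw [this, tentFn_right h hu1.le]; push_cast
    rw [show 2 * ((m:ℝ) + v) - (2 * m + 1) = 2 * v - 1 by ring]
    rcases le_total v 1 with h'' | h''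
    · rw [tentFn_right (by linarith) h'', clampFn_mid (by linarith) h'',
        clampFn_mid (by linarith) (by linarith)]; ring
    · rw [tentFn_of_one_le h'', clampFn_of_one_le h'', clampFn_of_one_le (by linarith)]; ring

lemma covG_near {x y : ℝ} (hx : 0 ≤ x) : |covG x y - x| ≤ 1 := by
  have h1 := Nat.floor_le hx
  have h2 := Nat.lt_floor_add_one x
  unfold covG
  have h3 := clampFn_nonneg (y - ⌊x⌋₊)
  have h4 := clampFn_le_one (y - ⌊x⌋₊)
  generalize clampFn (y - ⌊x⌋₊) = c at *
  rw [abs_le]; constructor <;> nlinarith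

/-- The coefficients of the Lévy–Ciesielski expansion. -/
noncomputable def schauder : ℕ → ℕ → ℝ → ℝ
  | 0, j, t => clampFn (t - j)
  | k + 1, j, t => (√2 ^ k)⁻¹ * tentFn (2 ^ k * t - j)

lemma continuous_schauder (k j : ℕ) : Continuous (schauder k j) := by
  cases k with
  | zero => exact continuous_clampFn.comp (by fun_prop)
  | succ k => exact continuous_const.mul (continuous_tentFn.comp (by fun_prop))

lemma schauder_eq_zero {k j : ℕ} {t : ℝ} (ht : 0 ≤ t) (h : 2 ^ k * t ≤ j) :
    schauder k j t = 0 := by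
  cases k with
  | zero => exact clampFn_of_nonpos (by simp at h; linarith)
  | succ k =>
    have : 0 ≤ 2 ^ k * t := by positivity
    simp only [schauder]
    rw [tentFn_of_nonpos, mul_zero]
    rw [pow_succ] at h; linarith

lemma tent_floor {x : ℝ} (hx : 0 ≤ x) {j : ℕ} (h : j ≠ ⌊x⌋₊) : tentFn (x - j) = 0 := by
  rcases lt_or_gt_of_ne h with h | h
  · apply tentFn_of_one_le
    have := Nat.floor_le hx
    have : (j : ℝ) + 1 ≤ ⌊x⌋₊ := by exact_mod_cast h
    linarith
  · apply tentFn_of_nonpos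
    have := Nat.lt_floor_add_one x
    have : (⌊x⌋₊ : ℝ) + 1 ≤ j := by exact_mod_cast h
    linarith

lemma sum_clamp {x y : ℝ} (hx : 0 ≤ x) (hxy : x ≤ y) {M : ℕ} (hM : x ≤ M) :
    ∑ j ∈ Finset.range M, clampFn (x - j) * clampFn (y - j) = covG x y := by
  have h1 := Nat.floor_le hx
  have h2 := Nat.lt_floor_add_one x
  have h3 : ⌊x⌋₊ ≤ M := Nat.floor_le_of_le hM
  unfold covG
  generalize ⌊x⌋₊ = m at *
  have key : ∀ M, m + 1 ≤ M → ∑ j ∈ Finset.range M, clampFn (x - j) * clampFn (y - j) =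
      m + (x - m) * clampFn (y - m) := by
    intro M hM'
    induction M, hM' using Nat.le_induction with
    | base =>
      rw [Finset.sum_range_succ, clampFn_mid (x := x - m) (by linarith) (by linarith)]
      congr 1
      rw [Finset.sum_congr rfl (g := fun _ => (1:ℝ))]
      · simp
      · intro j hj
        have : (j:ℝ) + 1 ≤ m := by exact_mod_cast Finset.mem_range.1 hj
        rw [clampFn_of_one_le (by linarith), clampFn_of_one_le (by linarith), one_mul]
    | succ n hn ih =>
      rw [Finset.sum_range_succ, ih]
      have : (m:ℝ) + 1 ≤ n := by exact_mod_cast hn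
      rw [clampFn_of_nonpos (x := x - n) (by linarith)]; ring
  rw [← key (M + 1) (by omega), Finset.sum_range_succ,
    clampFn_of_nonpos (x := x - M) (by linarith)]; ring

lemma sum_schauder_succ {s t : ℝ} (hs : 0 ≤ s) (k : ℕ) {M : ℕ}
    (hM : 2 ^ k * s < M) :
    ∑ j ∈ Finset.range M, schauder (k+1) j s * schauder (k+1) j t =
      (2 ^ k)⁻¹ * (tentFn (2 ^ k * s - ⌊2 ^ k * s⌋₊) * tentFn (2 ^ k * t - ⌊2 ^ k * s⌋₊)) := by
  have h0 : 0 ≤ 2 ^ k * s := by positivity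
  rw [Finset.sum_eq_single ⌊2 ^ k * s⌋₊]
  · simp only [schauder]
    have : (2 ^ k : ℝ)⁻¹ = (√2 ^ k)⁻¹ * (√2 ^ k)⁻¹ := by
      rw [← mul_inv, ← mul_pow, Real.mul_self_sqrt (by norm_num)]
    rw [this]; ring
  · intro j _ hj
    simp [schauder, tent_floor h0 hj]
  · intro h
    exact absurd (Finset.mem_range.2 ((Nat.floor_lt h0).2 hM)) h

lemma cov_partial {s t : ℝ} (hs : 0 ≤ s) (hst : s ≤ t) (K : ℕ) {M : ℕ}
    (hM : 2 ^ K * s < M) :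
    ∑ k ∈ Finset.range (K + 1), ∑ j ∈ Finset.range M, schauder k j s * schauder k j t =
      (2 ^ K)⁻¹ * covG (2 ^ K * s) (2 ^ K * t) := by
  induction K with
  | zero =>
    simp at hM
    simp [schauder, sum_clamp hs hst hM.le]
  | succ K ih =>
    have h0 : 0 ≤ 2 ^ K * s := by positivity
    have h1 : 2 ^ K * s < M := by rw [pow_succ] at hM; linarith
    rw [Finset.sum_range_succ, ih h1, sum_schauder_succ hs K h1, pow_succ' (2:ℝ) K, mul_assoc,
      mul_assoc, covG_double h0 (by gcongr)]
    field_simp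

lemma cov_limit {s t : ℝ} (hs : 0 ≤ s) :
    Filter.Tendsto (fun K : ℕ => (2 ^ K : ℝ)⁻¹ * covG (2 ^ K * s) (2 ^ K * t)) Filter.atTop
      (nhds s) := by
  rw [tendsto_iff_dist_tendsto_zero]
  have h2 : Filter.Tendsto (fun K : ℕ => (2 ^ K : ℝ)⁻¹) Filter.atTop (nhds 0) := by
    simpa using tendsto_pow_atTop_nhds_zero_of_lt_one (r := (2:ℝ)⁻¹) (by norm_num) (by norm_num)
  refine squeeze_zero (fun _ => dist_nonneg) (fun K => ?_) h2
  have := covG_near (x := 2 ^ K * s) (y := 2 ^ K * t) (by positivity)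
  rw [Real.dist_eq]
  have e : (2 ^ K : ℝ)⁻¹ * covG (2 ^ K * s) (2 ^ K * t) - s
      = (2 ^ K : ℝ)⁻¹ * (covG (2 ^ K * s) (2 ^ K * t) - 2 ^ K * s) := by field_simp
  rw [e, abs_mul, abs_of_pos (by positivity)]
  exact mul_le_of_le_one_right (by positivity) this

/-- One level of the expansion. -/
noncomputable def levelFn (x : ℕ → ℕ → ℝ) (k : ℕ) (t : ℝ) : ℝ :=
  ∑ j ∈ Finset.range (⌊2 ^ k * t⌋₊ + 1), schauder k j t * x k j

lemma levelFn_eq (x : ℕ → ℕ → ℝ) {k : ℕ} {t : ℝ} (ht : 0 ≤ t) {M : ℕ} (hM : 2 ^ k * t ≤ M) :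
    levelFn x k t = ∑ j ∈ Finset.range M, schauder k j t * x k j := by
  have key : ∀ M : ℕ, 2 ^ k * t ≤ M → levelFn x k t =
      ∑ j ∈ Finset.range (M + 1), schauder k j t * x k j := by
    intro M hM
    apply Finset.sum_subset
    · apply Finset.range_subset_range.2
      have := Nat.floor_le_of_le hM
      omega
    · intro j _ hj
      rw [schauder_eq_zero ht, zero_mul]
      have h2 := Nat.lt_floor_add_one (2 ^ k * t)
      have : (⌊2 ^ k * t⌋₊ : ℝ) + 1 ≤ j := by
        have := Finset.mem_range.not.1 hj
        exact_mod_cast not_lt.1 this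
      linarith
  rw [key M hM, Finset.sum_range_succ, schauder_eq_zero ht hM]; ring

lemma levelFn_succ_bound {x : ℕ → ℕ → ℝ} {C : ℝ}
    (hC : ∀ k j, |x k j| ^ 8 ≤ C * (2 ^ k * (j + 1) ^ 2)) {N : ℕ} {t : ℝ} (ht : 0 ≤ t)
    (htN : t ≤ N) (k : ℕ) :
    |levelFn x (k + 1) t| ≤ (2 * C * (N + 1) ^ 2) ^ (1/8 : ℝ) * ((1/2 : ℝ) ^ (1/8 : ℝ)) ^ k := by
  have h0 : 0 ≤ 2 ^ k * t := by positivity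
  have h00 : 0 ≤ 2 ^ (k + 1) * t := by positivity
  have hC0 : 0 ≤ C := by
    have := (pow_nonneg (abs_nonneg _) 8).trans (hC 0 0)
    simpa using this
  have e : levelFn x (k + 1) t = (√2 ^ k)⁻¹ * tentFn (2 ^ k * t - ⌊2 ^ k * t⌋₊)
      * x (k + 1) ⌊2 ^ k * t⌋₊ := by
    unfold levelFn
    rw [Finset.sum_eq_single ⌊2 ^ k * t⌋₊]
    · rfl
    · intro j _ hj
      simp [schauder, tent_floor h0 hj]
    · intro h
      exfalso; apply h
      rw [Finset.mem_range, Nat.lt_succ_iff]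
      apply Nat.floor_le_floor
      rw [pow_succ]; linarith
  have h8 : |levelFn x (k + 1) t| ^ 8 ≤ (2 * C * (N + 1) ^ 2) * (1/2) ^ k := by
    rw [e, abs_mul, mul_pow, abs_mul, abs_of_nonneg (tentFn_nonneg _), abs_of_pos (by positivity),
      mul_pow]
    have h1 : ((√2 ^ k)⁻¹) ^ 8 = ((1/2:ℝ) ^ k) ^ 4 := by
      have h2 : √2 ^ k * √2 ^ k = 2 ^ k := by
        rw [← mul_pow, Real.mul_self_sqrt (by norm_num)]
      rw [one_div, inv_pow (2:ℝ) k, ← h2, mul_inv]; ring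
    rw [h1]
    have h2 : tentFn (2 ^ k * t - ⌊2 ^ k * t⌋₊) ^ 8 ≤ 1 :=
      pow_le_one₀ (tentFn_nonneg _) (tentFn_le_one _)
    have h3 : ((⌊2 ^ k * t⌋₊ : ℝ) + 1) ≤ 2 ^ k * (N + 1) := by
      have := Nat.floor_le h0
      have h5 : 2 ^ k * t ≤ 2 ^ k * N := by gcongr
      have : (1:ℝ) ≤ 2 ^ k := one_le_pow₀ (by norm_num)
      linarith
    calc _ ≤ ((1/2:ℝ) ^ k) ^ 4 * 1 * (C * (2 ^ (k+1) * (2 ^ k * (N + 1)) ^ 2)) := by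
          refine mul_le_mul (by gcongr) ((hC _ _).trans (by gcongr)) (by positivity) (by positivity)
      _ = _ := by
          rw [one_div, inv_pow]
          field_simp
          ring

  have h9 := Real.rpow_le_rpow (by positivity) h8 (show (0:ℝ) ≤ 1/8 by norm_num)
  rw [Real.mul_rpow (by positivity) (by positivity)] at h9
  rw [← Real.rpow_natCast, ← Real.rpow_mul (abs_nonneg _)] at h9
  norm_num at h9 ⊢
  refine h9.trans_eq ?_
  congr 1
  rw [← Real.rpow_natCast, ← Real.rpow_natCast, ← Real.rpow_mul, ← Real.rpow_mul, mul_comm] <;> norm_num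


lemma continuousOn_levelFn (x : ℕ → ℕ → ℝ) (k N : ℕ) :
    ContinuousOn (fun t : ℝ≥0 => levelFn x k t) {t : ℝ≥0 | t < N} := by
  have : ContinuousOn (fun t : ℝ≥0 => ∑ j ∈ Finset.range (2 ^ k * N),
      schauder k j t * x k j) {t : ℝ≥0 | t < N} := by
    refine Continuous.continuousOn (continuous_finsetSum _ fun j _ => ?_)
    exact ((continuous_schauder k j).comp NNReal.continuous_coe).mul continuous_const
  refine this.congr fun t ht => levelFn_eq x t.coe_nonneg ?_
  have ht' : (t : ℝ) ≤ N := by exact_mod_cast (le_of_lt ht)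
  push_cast
  exact mul_le_mul_of_nonneg_left ht' (by positivity)

lemma summable_geom (A : ℝ) : Summable fun k : ℕ => A * ((1/2 : ℝ) ^ (1/8 : ℝ)) ^ k := by
  apply Summable.mul_left
  apply summable_geometric_of_lt_one (by positivity)
  exact Real.rpow_lt_one (by norm_num) (by norm_num) (by norm_num)

lemma summable_levelFn {x : ℕ → ℕ → ℝ}
    (hx : ∃ C : ℝ, ∀ k j : ℕ, |x k j| ^ 8 ≤ C * (2 ^ k * (j + 1) ^ 2)) (t : ℝ≥0) :
    Summable fun k => levelFn x k t := by
  obtain ⟨C, hC⟩ := hx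
  obtain ⟨N, hN⟩ := exists_nat_ge (t : ℝ)
  rw [← _root_.summable_nat_add_iff 1]
  exact Summable.of_norm_bounded (summable_geom _) fun k => levelFn_succ_bound hC t.coe_nonneg hN k

lemma continuous_tsum_levelFn {x : ℕ → ℕ → ℝ}
    (hx : ∃ C : ℝ, ∀ k j : ℕ, |x k j| ^ 8 ≤ C * (2 ^ k * (j + 1) ^ 2)) :
    Continuous fun t : ℝ≥0 => ∑' k, levelFn x k t := by
  have h1 : (fun t : ℝ≥0 => ∑' k, levelFn x k t) =
      fun t : ℝ≥0 => levelFn x 0 t + ∑' k, levelFn x (k + 1) t := by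
    funext t
    exact (summable_levelFn hx t).tsum_eq_zero_add
  rw [h1, continuous_iff_continuousAt]
  intro t
  obtain ⟨N, hN⟩ := exists_nat_gt t
  obtain ⟨C, hC⟩ := hx
  have : ContinuousOn (fun t : ℝ≥0 => levelFn x 0 t + ∑' k, levelFn x (k + 1) t)
      {t : ℝ≥0 | t < N} := by
    refine (continuousOn_levelFn x 0 N).add ?_
    refine continuousOn_tsum (fun k => continuousOn_levelFn x (k + 1) N) 
      (summable_geom ((2 * C * (N + 1) ^ 2) ^ (1/8 : ℝ))) ?_
    · intro k s hs
      exact levelFn_succ_bound hC s.coe_nonneg (by exact_mod_cast (le_of_lt hs)) k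
  exact this.continuousAt ((isOpen_Iio (a := (N : ℝ≥0))).mem_nhds hN)

open Complex in
lemma exists_noise : ∃ (Ω : Type) (_ : MeasurableSpace Ω) (P : Measure Ω) (ξ : ℕ → ℕ → Ω → ℝ),
    IsProbabilityMeasure P ∧ (∀ k j, Measurable (ξ k j)) ∧
    (∀ ω, ∃ C : ℝ, ∀ k j : ℕ, |ξ k j ω| ^ 8 ≤ C * (2 ^ k * (j + 1) ^ 2)) ∧
    ∀ (S : Finset (ℕ × ℕ)) (c : ℕ × ℕ → ℝ) (θ : ℝ),
      ∫ ω, exp (θ * (∑ p ∈ S, c p * ξ p.1 p.2 ω : ℝ) * I) ∂P =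
        exp (-((∑ p ∈ S, c p ^ 2 : ℝ) * θ ^ 2 / 2)) := by
  obtain ⟨Ω, mΩ, P, X, hXm, hXl, hXi, hP⟩ := exists_iid (ℕ × ℕ) (gaussianReal 0 1)
  -- the weights
  let w : ℕ × ℕ → ℝ := fun p => 2 ^ p.1 * ((p.2 : ℝ) + 1) ^ 2
  have hw : ∀ p, 0 < w p := fun p => by positivity
  have hws : Summable fun p => (w p)⁻¹ := by
    have h1 : Summable fun k : ℕ => ((2:ℝ) ^ k)⁻¹ := by
      simpa using summable_geometric_of_lt_one (r := (2:ℝ)⁻¹) (by norm_num) (by norm_num)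
    have h2 : Summable fun j : ℕ => (((j : ℝ) + 1) ^ 2)⁻¹ := by
      have := (_root_.summable_nat_add_iff 1).2 (Real.summable_nat_pow_inv.2 (show 1 < 2 by norm_num))
      simpa using this
    have := h1.mul_of_nonneg h2 (fun _ => by positivity) (fun _ => by positivity)
    simpa [w, mul_inv, mul_comm] using this
  let T : Ω → ENNReal := fun ω => ∑' p, ENNReal.ofReal ((w p)⁻¹ * |X p ω| ^ 8)
  have hTm : Measurable T := by
    refine Measurable.tsum fun p => ?_
    have := hXm p
    fun_prop
  have hmom : ∫⁻ x, ENNReal.ofReal (|x| ^ 8) ∂(gaussianReal 0 1) < ⊤ := by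
    have h := (memLp_id_gaussianReal (μ := 0) (v := 1) 8).integrable_norm_pow (by norm_num)
    have := h.lintegral_lt_top
    simpa using this
  have hT : ∫⁻ ω, T ω ∂P ≠ ⊤ := by
    have : ∫⁻ ω, T ω ∂P = ∑' p, ENNReal.ofReal ((w p)⁻¹) *
        ∫⁻ x, ENNReal.ofReal (|x| ^ 8) ∂(gaussianReal 0 1) := by
      rw [lintegral_tsum]
      · congr with p
        rw [← (hXl p).lintegral_comp (by fun_prop), ← lintegral_const_mul]
        · congr with ω
          rw [ENNReal.ofReal_mul (inv_nonneg.2 (hw p).le)]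
        · have := hXm p
          fun_prop
      · intro p
        have := hXm p
        fun_prop
    rw [this, ENNReal.tsum_mul_right]
    exact ENNReal.mul_ne_top hws.tsum_ofReal_ne_top hmom.ne
  have hTae : ∀ᵐ ω ∂P, T ω < ⊤ := ae_lt_top hTm hT
  let A : Set Ω := {ω | T ω < ⊤}
  have hA : MeasurableSet A := measurableSet_lt hTm measurable_const
  let Y : ℕ × ℕ → Ω → ℝ := fun p => A.indicator (X p)
  have hYX : ∀ p, X p =ᵐ[P] Y p := fun p => by
    filter_upwards [hTae] with ω hω
    exact (Set.indicator_of_mem (s := A) hω (X p)).symm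
  have hYm : ∀ p, Measurable (Y p) := fun p => (hXm p).indicator hA
  have hYi : iIndepFun Y P := hXi.congr hYX
  have hYl : ∀ p, HasLaw (Y p) (gaussianReal 0 1) P := fun p => (hXl p).congr (hYX p).symm
  refine ⟨Ω, mΩ, P, fun k j => Y (k, j), hP, fun k j => hYm _, fun ω => ?_, fun S c θ => ?_⟩
  · by_cases hω : ω ∈ A
    · refine ⟨(T ω).toReal, fun k j => ?_⟩
      have h1 : ENNReal.ofReal ((w (k, j))⁻¹ * |X (k, j) ω| ^ 8) ≤ T ω :=
        ENNReal.le_tsum (f := fun p => ENNReal.ofReal ((w p)⁻¹ * |X p ω| ^ 8)) (k, j)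
      rw [ENNReal.ofReal_le_iff_le_toReal (ne_of_lt hω)] at h1
      have h2 : Y (k, j) ω = X (k, j) ω := Set.indicator_of_mem hω _
      simp only [h2]
      rw [inv_mul_le_iff₀ (hw _)] at h1
      exact h1.trans_eq (mul_comm _ _)
    · refine ⟨0, fun k j => ?_⟩
      have h2 : Y (k, j) ω = 0 := Set.indicator_of_notMem hω _
      simp [h2]
  · have hZi : iIndepFun (fun p ω => c p * Y p ω) P :=
      hYi.comp (fun p x => c p * x) (fun p => by fun_prop)
    have hZm : ∀ p, AEMeasurable (fun ω => c p * Y p ω) P := fun p =>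
      ((hYm p).const_mul _).aemeasurable
    have hZr : iIndepFun (S.restrict fun p ω => c p * Y p ω) P :=
      iIndepFun.precomp (g := fun p : S => (p : ℕ × ℕ)) Subtype.val_injective hZi
    have h1 := congrFun (iIndepFun.charFun_map_fun_finsetSum_eq_prod (s := S)
      (X := fun p ω => c p * Y p ω) (P := P) (fun p _ => hZm p)
      hZr) θ
    rw [charFun_apply_real, integral_map] at h1
    · simp only at h1 ⊢
      rw [h1, Finset.prod_apply]
      have h3 : ∀ p, charFun (P.map fun ω => c p * Y p ω) θ =
          exp (-((c p ^ 2 : ℝ) * θ ^ 2 / 2)) := by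
        intro p
        rw [(gaussianReal_const_mul (hYl p) (c p)).map_eq, charFun_gaussianReal]
        congr 1
        simp
      simp only [h3]
      rw [← Complex.exp_sum]
      congr 1
      push_cast
      rw [Finset.sum_neg_distrib, Finset.sum_mul, Finset.sum_div]
    · exact (Finset.measurable_sum _ fun p _ => (hYm p).const_mul _).aemeasurable
    · exact Continuous.aestronglyMeasurable (by fun_prop)

theorem exists_brownianMotion :
    ∃ (Ω : Type) (mΩ : MeasurableSpace Ω) (P : Measure Ω) (B : ℝ≥0 → Ω → ℝ),
      IsProbabilityMeasure P ∧
      (∀ t, Measurable (B t)) ∧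
      (∀ ω, Continuous fun t => B t ω) ∧
      (∀ (n : ℕ) (t : Fin n → ℝ≥0) (a : Fin n → ℝ),
        P.map (fun ω => ∑ i, a i * B (t i) ω) =
          gaussianReal 0 (∑ i, ∑ j, a i * a j * (min (t i) (t j) : ℝ)).toNNReal) := by
  obtain ⟨Ω, mΩ, P, ξ, hP, hξm, hξb, hξc⟩ := exists_noise
  let W : ℕ → ℝ≥0 → Ω → ℝ := fun K t ω =>
    ∑ k ∈ Finset.range (K + 1), levelFn (fun k j => ξ k j ω) k t
  let B : ℝ≥0 → Ω → ℝ := fun t ω => ∑' k, levelFn (fun k j => ξ k j ω) k t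
  have hWB : ∀ t ω, Filter.Tendsto (fun K => W K t ω) Filter.atTop (nhds (B t ω)) := fun t ω =>
    ((summable_levelFn (hξb ω) t).hasSum.tendsto_sum_nat).comp (Filter.tendsto_add_atTop_nat 1)
  have hWm : ∀ K t, Measurable (W K t) := fun K t => by
    refine Finset.measurable_sum _ fun k _ => ?_
    unfold levelFn
    exact Finset.measurable_sum _ fun j _ => (hξm k j).const_mul _
  have hBm : ∀ t, Measurable (B t) := fun t =>
    measurable_of_tendsto_metrizable (fun K => hWm K t) (tendsto_pi_nhds.2 (hWB t))
  refine ⟨Ω, mΩ, P, B, hP, hBm, fun ω => continuous_tsum_levelFn (hξb ω), fun n t a => ?_⟩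
  -- truncation sizes
  have hM : ∀ K : ℕ, ∃ M : ℕ, ∀ i, 2 ^ K * (t i : ℝ) < M := by
    intro K
    obtain ⟨M, hM⟩ := exists_nat_gt (∑ i, 2 ^ K * (t i : ℝ))
    refine ⟨M, fun i => lt_of_le_of_lt ?_ hM⟩
    exact Finset.single_le_sum (f := fun i => 2 ^ K * (t i : ℝ)) (fun _ _ => by positivity)
      (Finset.mem_univ i)
  choose M hM using hM
  let S : ℕ → Finset (ℕ × ℕ) := fun K => Finset.range (K + 1) ×ˢ Finset.range (M K)
  let c : ℕ × ℕ → ℝ := fun p => ∑ i, a i * schauder p.1 p.2 (t i)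
  have hlin : ∀ K ω, ∑ i, a i * W K (t i) ω = ∑ p ∈ S K, c p * ξ p.1 p.2 ω := by
    intro K ω
    have h1 : ∀ i, W K (t i) ω = ∑ p ∈ S K, schauder p.1 p.2 (t i) * ξ p.1 p.2 ω := by
      intro i
      rw [Finset.sum_product]
      refine Finset.sum_congr rfl fun k hk => levelFn_eq _ (t i).coe_nonneg ?_
      refine le_trans ?_ (hM K i).le
      have : k ≤ K := Nat.lt_succ_iff.1 (Finset.mem_range.1 hk)
      exact mul_le_mul_of_nonneg_right (pow_le_pow_right₀ (by norm_num) this) (t i).coe_nonneg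
    simp only [h1, c, Finset.mul_sum, Finset.sum_mul]
    rw [Finset.sum_comm]
    simp only [mul_assoc]
  let v : ℝ := ∑ i, ∑ j, a i * a j * (min (t i) (t j) : ℝ)
  have hvar : ∀ K, ∑ p ∈ S K, c p ^ 2 = ∑ i, ∑ j, a i * a j *
      ((2 ^ K : ℝ)⁻¹ * covG (2 ^ K * min (t i : ℝ) (t j)) (2 ^ K * max (t i : ℝ) (t j))) := by
    intro K
    have h1 : ∀ i j, (2 ^ K : ℝ)⁻¹ * covG (2 ^ K * min (t i : ℝ) (t j))
        (2 ^ K * max (t i : ℝ) (t j)) =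
        ∑ p ∈ S K, schauder p.1 p.2 (t i) * schauder p.1 p.2 (t j) := by
      intro i j
      rw [Finset.sum_product]
      rcases le_total (t i : ℝ) (t j) with h | h
      · rw [min_eq_left h, max_eq_right h, ← cov_partial (t i).coe_nonneg h K (hM K i)]
      · rw [min_eq_right h, max_eq_left h, ← cov_partial (t j).coe_nonneg h K (hM K j)]
        simp only [mul_comm]
    simp only [h1, c, sq, Finset.sum_mul_sum]
    simp only [Finset.mul_sum]
    rw [Finset.sum_comm]
    refine Finset.sum_congr rfl fun i _ => ?_
    rw [Finset.sum_comm]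
    refine Finset.sum_congr rfl fun j _ => Finset.sum_congr rfl fun p _ => ?_
    ring
  have hlim : Filter.Tendsto (fun K => ∑ p ∈ S K, c p ^ 2) Filter.atTop (nhds v) := by
    simp only [hvar]
    refine tendsto_finsetSum _ fun i _ => tendsto_finsetSum _ fun j _ => ?_
    exact (cov_limit (le_min (t i).coe_nonneg (t j).coe_nonneg)).const_mul _
  have hv : 0 ≤ v := ge_of_tendsto' hlim fun K => Finset.sum_nonneg fun p _ => sq_nonneg _
  have hm : Measurable (fun ω => ∑ i, a i * B (t i) ω) :=
    Finset.measurable_sum _ fun i _ => (hBm _).const_mul _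
  have hmp : IsProbabilityMeasure (P.map (fun ω => ∑ i, a i * B (t i) ω)) :=
    Measure.isProbabilityMeasure_map hm.aemeasurable
  refine Measure.ext_of_charFun ?_
  funext θ
  rw [charFun_gaussianReal, charFun_apply_real, integral_map hm.aemeasurable
    (Continuous.aestronglyMeasurable (by fun_prop))]
  have hL : Filter.Tendsto
      (fun K => ∫ ω, Complex.exp (θ * (∑ i, a i * W K (t i) ω : ℝ) * Complex.I) ∂P) Filter.atTop
      (nhds (∫ ω, Complex.exp (θ * (∑ i, a i * B (t i) ω : ℝ) * Complex.I) ∂P)) := by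
    refine tendsto_integral_of_dominated_convergence (fun _ => 1) (fun K => ?_)
      (integrable_const _) (fun K => ?_) ?_
    · have : Measurable (fun ω => ∑ i, a i * W K (t i) ω) :=
        Finset.measurable_sum _ fun i _ => (hWm _ _).const_mul _
      exact Measurable.aestronglyMeasurable (by fun_prop)
    · filter_upwards with ω
      rw [← Complex.ofReal_mul, Complex.norm_exp_ofReal_mul_I]
    · filter_upwards with ω
      have h1 : Filter.Tendsto (fun K => ∑ i, a i * W K (t i) ω) Filter.atTop
          (nhds (∑ i, a i * B (t i) ω)) :=
        tendsto_finsetSum _ fun i _ => (hWB (t i) ω).const_mul _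
      have h2 : Continuous fun x : ℝ => Complex.exp (θ * (x : ℂ) * Complex.I) := by fun_prop
      exact (h2.tendsto _).comp h1
  have hR : Filter.Tendsto
      (fun K => ∫ ω, Complex.exp (θ * (∑ i, a i * W K (t i) ω : ℝ) * Complex.I) ∂P) Filter.atTop
      (nhds (Complex.exp (-((v : ℝ) * θ ^ 2 / 2)))) := by
    have h2 : Continuous fun x : ℝ => Complex.exp (-((x : ℂ) * θ ^ 2 / 2)) := by fun_prop
    refine ((h2.tendsto v).comp hlim).congr fun K => ?_
    simp only [hlin, Function.comp]
    exact (hξc (S K) c θ).symm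
  rw [tendsto_nhds_unique hL hR]
  congr 1
  have : ((v.toNNReal : ℝ≥0) : ℝ) = v := Real.coe_toNNReal _ hv
  change -((v : ℂ) * θ ^ 2 / 2) = θ * (0 : ℝ) * Complex.I - ((v.toNNReal : ℝ) : ℂ) * θ ^ 2 / 2
  rw [this]
  simp
end

section
/- Kolmogorov–Chentsov continuity theorem: Let T be a second-countable extended pseudo-metric space with bounded covering number with constant c > 0 and exponent d > 0, let E be a complete extended pseudo-metric space, and let (X_t)_{t∈T} be a stochastic process satisfying the Kolmogorov condition for exponents (p, q) with constant M, where p > 0 and q > d. Then X has a modification Y whose paths are Hölder continuous of exponent β for every β ∈ (0, (q − d)/p). -/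
open MeasureTheory ENNReal NNReal Set

/-- A subset `A` of a pseudo-emetric space has bounded (internal) covering number with constant
`c` and exponent `d` if for every `ε ∈ (0, diam A]`, `A` can be covered by at most `c * ε ^ (-d)`
balls of radius `ε` centered in `A`. -/
def HasBoundedInternalCoveringNumber {T : Type*} [PseudoEMetricSpace T]
    (A : Set T) (c : ℝ≥0∞) (d : ℝ) : Prop :=
  ∀ ε : ℝ≥0∞, 0 < ε → ε ≤ EMetric.diam A →
    ∃ S : Finset T, ↑S ⊆ A ∧ (∀ t ∈ A, ∃ s ∈ S, edist t s ≤ ε) ∧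
      (S.card : ℝ≥0∞) ≤ c * ε ^ (-d)

/-- A stochastic process `X : T → Ω → E` satisfies the Kolmogorov condition for exponents
`(p, q)` with constant `M` if the pair `(X s, X t)` is measurable for the Borel σ-algebra on
`E × E` for all `s t : T`, and `E[d_E(X s, X t) ^ p] ≤ M * d_T(s, t) ^ q`. -/
def IsKolmogorovProcess {T Ω E : Type*} [PseudoEMetricSpace T] [PseudoEMetricSpace E]
    [MeasurableSpace Ω] (X : T → Ω → E) (P : Measure Ω) (p q : ℝ) (M : ℝ≥0) : Prop :=
  (∀ s t : T, @Measurable Ω (E × E) _ (borel (E × E)) fun ω => (X s ω, X t ω)) ∧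
  ∀ s t : T, ∫⁻ ω, edist (X s ω) (X t ω) ^ p ∂P ≤ (M : ℝ≥0∞) * edist s t ^ q

open Filter Topology

lemma kc_cover {T : Type*} [PseudoEMetricSpace T] [Nonempty T] {c : ℝ≥0} {d : ℝ} (hd : 0 < d)
    (hT : HasBoundedInternalCoveringNumber (Set.univ : Set T) c d) :
    ∃ R : ℝ≥0, 1 ≤ R ∧ (∀ s t : T, edist s t ≤ R) ∧ ∃ S : ℕ → Finset T,
      (∀ n t, ∃ s ∈ S n, edist t s ≤ R * (2⁻¹ : ℝ≥0∞) ^ n) ∧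
      ∀ n, ((S n).card : ℝ≥0∞) ≤ (c + 1) * ((2 : ℝ≥0∞) ^ d) ^ n := by
  have hfin : EMetric.diam (Set.univ : Set T) ≠ ∞ := by
    intro h
    obtain ⟨S, -, h1, h2⟩ := hT ∞ (by simp) (by rw [h])
    rw [ENNReal.top_rpow_of_neg (by linarith), mul_zero] at h2
    obtain ⟨s, hs, -⟩ := h1 (Classical.arbitrary T) (Set.mem_univ _)
    have : S.card = 0 := by simpa using h2
    rw [Finset.card_eq_zero] at this
    simp [this] at hs
  set D := EMetric.diam (Set.univ : Set T) with hD
  refine ⟨D.toNNReal + 1, by simp, fun s t => ?_, ?_⟩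
  · calc edist s t ≤ D := Metric.edist_le_ediam_of_mem (Set.mem_univ _) (Set.mem_univ _)
      _ ≤ _ := by push_cast; rw [ENNReal.coe_toNNReal hfin]; simp
  have key : ∀ n : ℕ, ∃ S : Finset T,
      (∀ t, ∃ s ∈ S, edist t s ≤ ((D.toNNReal + 1 : ℝ≥0) : ℝ≥0∞) * (2⁻¹ : ℝ≥0∞) ^ n) ∧
      (S.card : ℝ≥0∞) ≤ (c + 1) * ((2 : ℝ≥0∞) ^ d) ^ n := by
    intro n
    have h1 : (1 : ℝ≥0∞) ≤ ((2 : ℝ≥0∞) ^ d) ^ n :=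
      one_le_pow₀ (ENNReal.one_le_rpow (by norm_num) hd)
    rcases le_or_gt (((D.toNNReal + 1 : ℝ≥0) : ℝ≥0∞) * (2⁻¹ : ℝ≥0∞) ^ n) D with h | h
    · obtain ⟨S, -, hS, hc⟩ := hT _ (by
        apply ENNReal.mul_pos
        · simp
        · simp) h
      refine ⟨S, fun t => hS t (Set.mem_univ _), hc.trans ?_⟩
      gcongr
      · simp
      · calc (((D.toNNReal + 1 : ℝ≥0) : ℝ≥0∞) * (2⁻¹ : ℝ≥0∞) ^ n) ^ (-d)
            ≤ ((2⁻¹ : ℝ≥0∞) ^ n) ^ (-d) := by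
              rw [ENNReal.rpow_neg, ENNReal.rpow_neg, ENNReal.inv_le_inv]
              gcongr
              apply le_mul_of_one_le_left (by simp)
              push_cast; simp
          _ = _ := by
              rw [← ENNReal.inv_pow, ENNReal.inv_rpow, ENNReal.rpow_neg, inv_inv,
                ← ENNReal.rpow_natCast, ← ENNReal.rpow_natCast, ← ENNReal.rpow_mul,
                ← ENNReal.rpow_mul, mul_comm]
    · refine ⟨{Classical.arbitrary T}, fun t => ⟨_, Finset.mem_singleton_self _, ?_⟩, ?_⟩
      · exact (Metric.edist_le_ediam_of_mem (Set.mem_univ _) (Set.mem_univ _)).trans h.le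
      · simp only [Finset.card_singleton, Nat.cast_one]
        calc (1 : ℝ≥0∞) = 1 * 1 := by simp
          _ ≤ _ := by gcongr; simp
  choose S hS using key
  exact ⟨S, fun n => (hS n).1, fun n => (hS n).2⟩

lemma kc_geom {r : ℝ} (h0 : 0 ≤ r) (h1 : r < 1) {q : ℝ} :
    ∑' n : ℕ, ((n : ℝ≥0∞) + 1) ^ q * (ENNReal.ofReal r) ^ n ≠ ∞ := by
  obtain ⟨k, hk⟩ := exists_nat_ge q
  rcases h0.eq_or_lt with rfl | hr
  · rw [tsum_eq_single 0]
    · simp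
    · intro n hn; simp [hn]
  have hs : Summable fun n : ℕ => ((n : ℝ) + 1) ^ k * r ^ n := by
    have := (_root_.summable_nat_add_iff 1).2 (summable_pow_mul_geometric_of_norm_lt_one (R := ℝ) k
      (r := r) (by rwa [Real.norm_of_nonneg h0]))
    refine (this.mul_left r⁻¹).congr fun n => ?_
    push_cast
    field_simp
    ring
  refine ne_top_of_le_ne_top hs.tsum_ofReal_ne_top (ENNReal.tsum_le_tsum fun n => ?_)
  rw [ENNReal.ofReal_mul (by positivity), ENNReal.ofReal_pow h0, ENNReal.ofReal_pow (by positivity),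
    ENNReal.ofReal_add (by positivity) (by positivity)]
  gcongr
  rw [← ENNReal.rpow_natCast]
  simp only [ENNReal.ofReal_natCast, ENNReal.ofReal_one]
  exact ENNReal.rpow_le_rpow_of_exponent_le (by simp) hk

lemma kc_g_lt {β : ℝ} (hβ : 0 < β) : (2⁻¹ : ℝ≥0∞) ^ β < 1 :=
  ENNReal.rpow_lt_one (by simp) hβ

lemma kc_step {T E : Type*} [PseudoEMetricSpace T] [PseudoEMetricSpace E]
    {R B : ℝ≥0} {β : ℝ} {S : ℕ → Finset T} {π : ℕ → T → T} [DecidableEq T]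
    (hπS : ∀ n t, π n t ∈ S n) (hπ : ∀ n t, edist t (π n t) ≤ R * (2⁻¹ : ℝ≥0∞) ^ n)
    {f : T → E}
    (hB : ∀ n, ∀ s ∈ S n ∪ S (n + 1), ∀ t ∈ S n ∪ S (n + 1),
      edist s t ≤ 4 * (R * (2⁻¹ : ℝ≥0∞) ^ n) →
      edist (f s) (f t) ≤ B * ((2⁻¹ : ℝ≥0∞) ^ β) ^ n) (t : T) (n : ℕ) :
    edist (f (π n t)) (f (π (n + 1) t)) ≤ B * ((2⁻¹ : ℝ≥0∞) ^ β) ^ n := by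
  apply hB n _ (by simp [hπS]) _ (by simp [hπS])
  calc edist (π n t) (π (n+1) t) ≤ edist t (π n t) + edist t (π (n+1) t) :=
        edist_triangle_left _ _ _
    _ ≤ R * (2⁻¹ : ℝ≥0∞) ^ n + R * (2⁻¹ : ℝ≥0∞) ^ n := by
        refine add_le_add (hπ _ _) ((hπ _ _).trans ?_)
        refine mul_le_mul' le_rfl ?_
        exact pow_le_pow_of_le_one zero_le (by simp) (Nat.le_succ n)
    _ = 2 * (R * (2⁻¹ : ℝ≥0∞) ^ n) := by ring
    _ ≤ _ := by gcongr; norm_num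

lemma kc_holder {T E : Type*} [PseudoEMetricSpace T] [PseudoEMetricSpace E]
    {R B β : ℝ≥0} (hR : 1 ≤ R) (hβ : 0 < β) {S : ℕ → Finset T} {π : ℕ → T → T} [DecidableEq T]
    (hRT : ∀ s t : T, edist s t ≤ R)
    (hπS : ∀ n t, π n t ∈ S n) (hπ : ∀ n t, edist t (π n t) ≤ R * (2⁻¹ : ℝ≥0∞) ^ n)
    {f : T → E}
    (hB : ∀ n, ∀ s ∈ S n ∪ S (n + 1), ∀ t ∈ S n ∪ S (n + 1),
      edist s t ≤ 4 * (R * (2⁻¹ : ℝ≥0∞) ^ n) →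
      edist (f s) (f t) ≤ B * ((2⁻¹ : ℝ≥0∞) ^ (β : ℝ)) ^ n)
    {L : T → E} (hL : ∀ t, Tendsto (fun n => f (π n t)) atTop (𝓝 (L t))) :
    ∃ C : ℝ≥0, HolderWith C β L := by
  have hg := kc_g_lt (β := (β : ℝ)) (by exact_mod_cast hβ)
  have hg0 : (2⁻¹ : ℝ≥0∞) ^ (β : ℝ) ≠ 0 := by simp
  set g : ℝ≥0∞ := (2⁻¹ : ℝ≥0∞) ^ (β : ℝ) with hgdef
  have h1 : ∀ t n, edist (f (π n t)) (L t) ≤ B * g ^ n / (1 - g) := fun t n =>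
    edist_le_of_edist_le_geometric_of_tendsto g B (fun n => kc_step hπS hπ hB t n) (hL t) n
  set D : ℝ≥0∞ := B / (1 - g) + B + B / (1 - g) with hDdef
  have hsub : 1 - g ≠ 0 := (tsub_pos_iff_lt.2 hg).ne'
  have hD : D ≠ ∞ := by
    have : (B : ℝ≥0∞) / (1 - g) ≠ ∞ := ENNReal.div_ne_top (by simp) hsub
    simp [hDdef, this]
  have h2 : ∀ s t n, edist s t ≤ R * (2⁻¹ : ℝ≥0∞) ^ n → edist (L s) (L t) ≤ D * g ^ n := by
    intro s t n hst
    have h3 : edist (f (π n s)) (f (π n t)) ≤ B * g ^ n := by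
      apply hB n _ (by simp [hπS]) _ (by simp [hπS])
      calc edist (π n s) (π n t) ≤ edist (π n s) s + edist s t + edist t (π n t) :=
            edist_triangle4 _ _ _ _
        _ ≤ R * (2⁻¹ : ℝ≥0∞) ^ n + R * (2⁻¹ : ℝ≥0∞) ^ n + R * (2⁻¹ : ℝ≥0∞) ^ n := by
            rw [edist_comm (π n s) s]
            exact add_le_add (add_le_add (hπ _ _) hst) (hπ _ _)
        _ = 3 * (R * (2⁻¹ : ℝ≥0∞) ^ n) := by ring
        _ ≤ _ := by gcongr; norm_num
    calc edist (L s) (L t)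
        ≤ edist (L s) (f (π n s)) + edist (f (π n s)) (f (π n t)) + edist (f (π n t)) (L t) :=
          edist_triangle4 _ _ _ _
      _ ≤ B * g ^ n / (1 - g) + B * g ^ n + B * g ^ n / (1 - g) := by
          rw [edist_comm (L s)]
          exact add_le_add (add_le_add (h1 _ _) h3) (h1 _ _)
      _ = _ := by simp only [hDdef, div_eq_mul_inv]; ring
  refine ⟨(D * g⁻¹).toNNReal, fun s t => ?_⟩
  rw [ENNReal.coe_toNNReal (ENNReal.mul_ne_top hD (by simp [hg0]))]
  by_cases hst : edist s t = 0
  · have h3 : Tendsto (fun n : ℕ => D * g ^ n) atTop (𝓝 (D * 0)) :=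
      ENNReal.Tendsto.const_mul (ENNReal.tendsto_pow_atTop_nhds_zero_of_lt_one hg) (Or.inr hD)
    have h4 := ge_of_tendsto' h3 (fun n => h2 s t n (by simp [hst]))
    rw [mul_zero] at h4
    exact h4.trans (by simp)
  · have hex : ∃ m : ℕ, R * (2⁻¹ : ℝ≥0∞) ^ m < edist s t := by
      have h3 : Tendsto (fun n : ℕ => (R : ℝ≥0∞) * (2⁻¹ : ℝ≥0∞) ^ n) atTop (𝓝 (R * 0)) :=
        ENNReal.Tendsto.const_mul (ENNReal.tendsto_pow_atTop_nhds_zero_of_lt_one (by simp))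
          (Or.inr (by simp))
      rw [mul_zero] at h3
      exact (h3.eventually_lt_const (pos_iff_ne_zero.2 hst)).exists
    classical
    obtain ⟨n, hn⟩ : ∃ n, Nat.find hex = n + 1 := by
      apply Nat.exists_eq_succ_of_ne_zero
      intro h0
      have := Nat.find_spec hex
      rw [h0] at this
      exact absurd (hRT s t) (not_le.2 (by simpa using this))
    have ha := Nat.find_spec hex
    rw [hn] at ha
    have hb := Nat.find_min hex (m := n) (by omega)
    rw [not_lt] at hb
    refine (h2 s t n hb).trans ?_
    rw [mul_assoc]
    gcongr
    have hgt : g ≠ ∞ := (hg.trans ENNReal.one_lt_top).ne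
    calc g ^ n = g⁻¹ * g ^ (n + 1) := by
          rw [pow_succ', ← mul_assoc, ENNReal.inv_mul_cancel hg0 hgt, one_mul]
      _ ≤ g⁻¹ * edist s t ^ (β : ℝ) := by
          gcongr
          rw [hgdef, ← ENNReal.rpow_natCast, ← ENNReal.rpow_mul, mul_comm, ENNReal.rpow_mul,
            ENNReal.rpow_natCast]
          gcongr
          refine le_trans ?_ ha.le
          apply le_mul_of_one_le_left (by simp)
          exact_mod_cast hR

lemma kc_meas {T Ω E : Type*} [PseudoEMetricSpace T] [PseudoEMetricSpace E]
    [MeasurableSpace Ω] {X : T → Ω → E} {P : Measure Ω} {p q : ℝ} {M : ℝ≥0}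
    (hX : IsKolmogorovProcess X P p q M) (s t : T) :
    Measurable fun ω => edist (X s ω) (X t ω) ^ p := by
  have : Measurable fun ω => edist (X s ω) (X t ω) := by
    borelize (E × E)
    exact (continuous_edist.stronglyMeasurable.comp_measurable (hX.1 s t)).measurable
  exact this.pow_const p

lemma kc_exponents {β d p q : ℝ} (n : ℕ) :
    ((2 : ℝ≥0∞) ^ (β * p)) ^ n * (((2 : ℝ≥0∞) ^ d) ^ n * ((2⁻¹ : ℝ≥0∞) ^ n) ^ q)
      = (ENNReal.ofReal ((2 : ℝ) ^ (β * p + d - q))) ^ n := by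
  have h2 : (2⁻¹ : ℝ≥0∞) = (2 : ℝ≥0∞) ^ (-1 : ℝ) := by rw [ENNReal.rpow_neg_one]
  rw [h2, ← ENNReal.ofReal_rpow_of_pos (by norm_num)]
  simp only [ENNReal.ofReal_ofNat]
  simp only [← ENNReal.rpow_natCast, ← ENNReal.rpow_mul]
  rw [← ENNReal.rpow_add _ _ (by simp) (by simp), ← ENNReal.rpow_add _ _ (by simp) (by simp)]
  congr 1
  ring

lemma kc_prob {T Ω E : Type*} [PseudoEMetricSpace T] [DecidableEq T] [PseudoEMetricSpace E]
    [MeasurableSpace Ω] {X : T → Ω → E} {P : Measure Ω} {d p q : ℝ} {c M R : ℝ≥0}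
    (hd : 0 < d) (hp : 0 < p) (hq : d < q)
    (hX : IsKolmogorovProcess X P p q M) {S : ℕ → Finset T}
    (hS : ∀ n, ((S n).card : ℝ≥0∞) ≤ (c + 1) * ((2 : ℝ≥0∞) ^ d) ^ n)
    {β : ℝ} (hβ : β < (q - d) / p) :
    ∀ᵐ ω ∂P, ∃ B : ℝ≥0, ∀ n, ∀ s ∈ S n ∪ S (n + 1), ∀ t ∈ S n ∪ S (n + 1),
      edist s t ≤ 4 * (R * (2⁻¹ : ℝ≥0∞) ^ n) →
      edist (X s ω) (X t ω) ≤ B * ((2⁻¹ : ℝ≥0∞) ^ β) ^ n := by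
  have hq0 : 0 < q := hd.trans hq
  set a : ℝ≥0∞ := 2 * (c + 1) * (2 : ℝ≥0∞) ^ d with ha
  have h2d : (1 : ℝ≥0∞) ≤ (2 : ℝ≥0∞) ^ d := ENNReal.one_le_rpow (by norm_num) hd
  have h2dt : (2 : ℝ≥0∞) ^ d ≠ ∞ := by simp
  have hat : a ≠ ∞ := by
    rw [ha]; exact ENNReal.mul_ne_top (ENNReal.mul_ne_top (by simp) (by simp)) h2dt
  have hcard : ∀ n, ((S n ∪ S (n + 1)).card : ℝ≥0∞) ≤ a * ((2 : ℝ≥0∞) ^ d) ^ n := by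
    intro n
    calc ((S n ∪ S (n + 1)).card : ℝ≥0∞) ≤ (S n).card + (S (n + 1)).card := by
          exact_mod_cast Finset.card_union_le _ _
      _ ≤ (c + 1) * ((2 : ℝ≥0∞) ^ d) ^ (n + 1) + (c + 1) * ((2 : ℝ≥0∞) ^ d) ^ (n + 1) := by
          refine add_le_add ((hS n).trans ?_) (hS _)
          refine mul_le_mul' le_rfl ?_
          exact pow_le_pow_right₀ h2d (Nat.le_succ n)
      _ = _ := by rw [ha]; ring
  have hcard' : ∀ n, ((S n ∪ S (n + 1)).card : ℝ≥0∞) ≤ a ^ (n + 1) := by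
    intro n
    refine (hcard n).trans ?_
    rw [pow_succ' a]
    gcongr
    rw [ha]
    apply le_mul_of_one_le_left zero_le
    calc (1 : ℝ≥0∞) = 1 * 1 := by simp
      _ ≤ _ := by gcongr <;> simp
  have hK := fun n => EMetric.pair_reduction (hcard' n) (4 * (R * (2⁻¹ : ℝ≥0∞) ^ n)) E
  choose K hKJ hKc hKd hKf using hK
  set w : ℝ≥0∞ := (2 : ℝ≥0∞) ^ (β * p) with hw
  set G : ℕ → Ω → ℝ≥0∞ := fun n ω =>
    w ^ n * ∑ k ∈ K n, edist (X k.1 ω) (X k.2 ω) ^ p with hG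
  have hGm : ∀ n, Measurable (G n) := fun n =>
    (Finset.measurable_sum _ fun k _ => kc_meas hX k.1 k.2).const_mul _
  set C0 : ℝ≥0∞ := a * a * M * (4 * R : ℝ≥0∞) ^ q with hC0
  have hC0t : C0 ≠ ∞ := by
    have : (4 * R : ℝ≥0∞) ^ q ≠ ∞ :=
      ENNReal.rpow_ne_top_of_nonneg hq0.le (ENNReal.mul_ne_top (by simp) (by simp))
    exact ENNReal.mul_ne_top (ENNReal.mul_ne_top (ENNReal.mul_ne_top hat hat) (by simp)) this
  set r : ℝ := (2 : ℝ) ^ (β * p + d - q) with hr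
  have hr1 : r < 1 := by
    apply Real.rpow_lt_one_of_one_lt_of_neg (by norm_num)
    rw [lt_div_iff₀ hp] at hβ
    linarith
  have hGi : ∀ n, ∫⁻ ω, G n ω ∂P ≤ C0 * (((n : ℝ≥0∞) + 1) ^ q * (ENNReal.ofReal r) ^ n) := by
    intro n
    rw [hG]
    simp only
    rw [lintegral_const_mul _ (Finset.measurable_sum _ fun k _ => kc_meas hX k.1 k.2),
      lintegral_finsetSum _ (fun k _ => kc_meas hX k.1 k.2)]
    calc w ^ n * ∑ k ∈ K n, ∫⁻ ω, edist (X k.1 ω) (X k.2 ω) ^ p ∂P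
        ≤ w ^ n * ∑ k ∈ K n, M * (((n + 1 : ℕ) : ℝ≥0∞) * (4 * (R * (2⁻¹ : ℝ≥0∞) ^ n))) ^ q := by
          gcongr with k hk
          refine (hX.2 k.1 k.2).trans ?_
          gcongr
          exact hKd n k.1 k.2 hk
      _ = w ^ n * ((K n).card * (M * (((n + 1 : ℕ) : ℝ≥0∞) * (4 * (R * (2⁻¹ : ℝ≥0∞) ^ n))) ^ q)) := by
          rw [Finset.sum_const, nsmul_eq_mul]
      _ ≤ w ^ n * ((a * (a * ((2 : ℝ≥0∞) ^ d) ^ n)) *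
            (M * (((n + 1 : ℕ) : ℝ≥0∞) * (4 * (R * (2⁻¹ : ℝ≥0∞) ^ n))) ^ q)) := by
          gcongr
          refine (hKc n).trans ?_
          gcongr
          exact hcard n
      _ = _ := by
          rw [hr, ← kc_exponents, hC0, hw, ← mul_assoc 4, ENNReal.mul_rpow_of_nonneg _ _ hq0.le,
            ENNReal.mul_rpow_of_nonneg _ _ hq0.le]
          push_cast
          ring
  have hint : ∫⁻ ω, ∑' n, G n ω ∂P ≠ ∞ := by
    rw [lintegral_tsum fun n => (hGm n).aemeasurable]
    refine ne_top_of_le_ne_top ?_ (ENNReal.tsum_le_tsum hGi)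
    rw [ENNReal.tsum_mul_left]
    exact ENNReal.mul_ne_top hC0t (kc_geom (by positivity) hr1)
  filter_upwards [ae_lt_top (Measurable.ennreal_tsum hGm) hint] with ω hω
  set Z := ∑' n, G n ω with hZ
  have hZt : Z ^ (1 / p) ≠ ∞ := ENNReal.rpow_ne_top_of_nonneg (by positivity) hω.ne
  refine ⟨(2 * Z ^ (1 / p)).toNNReal, fun n s hs t ht hst => ?_⟩
  rw [ENNReal.coe_toNNReal (ENNReal.mul_ne_top (by simp) hZt)]
  have h1 : edist (X s ω) (X t ω) ≤ 2 * ⨆ k : K n, edist (X k.1.1 ω) (X k.1.2 ω) := by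
    refine le_trans ?_ (hKf n (fun t => X t ω))
    exact le_iSup_of_le (⟨s, hs⟩ : { x // x ∈ S n ∪ S (n + 1) })
      (le_iSup (fun t' : { t' : { x // x ∈ S n ∪ S (n + 1) } // edist s t' ≤ _ } =>
        edist (X s ω) (X t' ω)) ⟨⟨t, ht⟩, hst⟩)
  refine h1.trans ?_
  rw [mul_assoc]
  gcongr
  refine iSup_le fun k => ?_
  have h2 : w ^ n * edist (X k.1.1 ω) (X k.1.2 ω) ^ p ≤ Z := by
    refine le_trans ?_ (ENNReal.le_tsum n)
    simp only [hG]
    gcongr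
    exact Finset.single_le_sum (f := fun k : T × T => edist (X k.1 ω) (X k.2 ω) ^ p)
      (fun _ _ => zero_le) k.2
  have h3 : ((2 : ℝ≥0∞) ^ β) ^ n * edist (X k.1.1 ω) (X k.1.2 ω) ≤ Z ^ (1 / p) := by
    rw [one_div, ENNReal.le_rpow_inv_iff hp, ENNReal.mul_rpow_of_nonneg _ _ hp.le]
    convert h2 using 2
    rw [hw]
    simp only [← ENNReal.rpow_natCast, ← ENNReal.rpow_mul]
    congr 1
    ring
  have h4 : ((2⁻¹ : ℝ≥0∞) ^ β) ^ n * ((2 : ℝ≥0∞) ^ β) ^ n = 1 := by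
    rw [← mul_pow, ENNReal.inv_rpow, ENNReal.inv_mul_cancel (by simp) (by simp), one_pow]
  calc edist (X k.1.1 ω) (X k.1.2 ω)
      = ((2⁻¹ : ℝ≥0∞) ^ β) ^ n * (((2 : ℝ≥0∞) ^ β) ^ n * edist (X k.1.1 ω) (X k.1.2 ω)) := by
        rw [← mul_assoc, h4, one_mul]
    _ ≤ ((2⁻¹ : ℝ≥0∞) ^ β) ^ n * Z ^ (1 / p) := by gcongr
    _ = _ := mul_comm _ _

lemma kc_modif {T Ω E : Type*} [PseudoEMetricSpace T] [PseudoEMetricSpace E]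
    [MeasurableSpace Ω] {X : T → Ω → E} {P : Measure Ω} {p q : ℝ} {M R : ℝ≥0}
    (hp : 0 < p) (hq : 0 < q)
    (hX : IsKolmogorovProcess X P p q M) {t : T} {u : ℕ → T}
    (hu : ∀ n, edist t (u n) ≤ R * (2⁻¹ : ℝ≥0∞) ^ n) :
    ∀ᵐ ω ∂P, Tendsto (fun n => X (u n) ω) atTop (𝓝 (X t ω)) := by
  have hint : ∫⁻ ω, ∑' n, edist (X (u n) ω) (X t ω) ^ p ∂P ≠ ∞ := by
    rw [lintegral_tsum fun n => (kc_meas hX _ _).aemeasurable]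
    have : ∀ n, ∫⁻ ω, edist (X (u n) ω) (X t ω) ^ p ∂P ≤
        (M * (R : ℝ≥0∞) ^ q) * ((2⁻¹ : ℝ≥0∞) ^ q) ^ n := by
      intro n
      refine (hX.2 _ _).trans ?_
      rw [mul_assoc, edist_comm]
      gcongr
      calc edist t (u n) ^ q ≤ (R * (2⁻¹ : ℝ≥0∞) ^ n) ^ q := by gcongr; exact hu n
        _ = _ := by
          rw [ENNReal.mul_rpow_of_nonneg _ _ hq.le]
          simp only [← ENNReal.rpow_natCast, ← ENNReal.rpow_mul]
          rw [mul_comm (n : ℝ)]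
    refine ne_top_of_le_ne_top ?_ (ENNReal.tsum_le_tsum this)
    rw [ENNReal.tsum_mul_left, ENNReal.tsum_geometric]
    refine ENNReal.mul_ne_top (ENNReal.mul_ne_top (by simp)
      (ENNReal.rpow_ne_top_of_nonneg hq.le (by simp))) ?_
    rw [ENNReal.inv_ne_top]
    exact (tsub_pos_iff_lt.2 (kc_g_lt hq)).ne'
  filter_upwards [ae_lt_top (Measurable.ennreal_tsum fun n => kc_meas hX _ _) hint] with ω hω
  have h1 := ENNReal.tendsto_atTop_zero_of_tsum_ne_top hω.ne
  rw [tendsto_iff_edist_tendsto_0]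
  have h2 := (ENNReal.continuous_rpow_const (y := 1 / p)).tendsto 0 |>.comp h1
  rw [ENNReal.zero_rpow_of_pos (by positivity)] at h2
  refine h2.congr fun n => ?_
  simp only [Function.comp]
  rw [← ENNReal.rpow_mul, mul_one_div_cancel hp.ne', ENNReal.rpow_one]

/-- **Kolmogorov–Chentsov continuity theorem.** Let `T` be a second-countable pseudo-emetric
space with bounded covering number with constant `c > 0` and exponent `d > 0`, let `E` be a
complete pseudo-emetric space and let `X` be a stochastic process satisfying the Kolmogorov
condition for exponents `(p, q)` with constant `M`, where `p > 0` and `q > d`. Then `X` has a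
modification `Y` whose paths are Hölder continuous of exponent `β` for every
`β ∈ (0, (q - d) / p)`. -/
theorem kolmogorov_chentsov {T Ω E : Type*} [PseudoEMetricSpace T] [SecondCountableTopology T]
    [MeasurableSpace Ω] [PseudoEMetricSpace E] [CompleteSpace E]
    {P : Measure Ω} [IsProbabilityMeasure P] {X : T → Ω → E}
    {c M : ℝ≥0} {d p q : ℝ}
    (hc : 0 < c) (hd : 0 < d) (hp : 0 < p) (hq : d < q)
    (hT : HasBoundedInternalCoveringNumber (Set.univ : Set T) c d)
    (hX : IsKolmogorovProcess X P p q M) :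
    ∃ Y : T → Ω → E,
      (∀ t, ∀ᵐ ω ∂P, Y t ω = X t ω) ∧
      ∀ (β : ℝ≥0), 0 < β → (β : ℝ) < (q - d) / p →
        ∀ ω, ∃ C : ℝ≥0, HolderWith C β fun t => Y t ω := by
  classical
  rcases isEmpty_or_nonempty T with hTe | hTn
  · exact ⟨X, fun t => isEmptyElim t, fun β _ _ ω => ⟨0, fun s => isEmptyElim s⟩⟩
  have hΩ : Nonempty Ω := nonempty_of_isProbabilityMeasure P
  have x0 : E := X (Classical.arbitrary T) (Classical.arbitrary Ω)
  obtain ⟨R, hR, hRT, S, hSc, hScard⟩ := kc_cover hd hT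
  choose π hπS hπ using hSc
  set Good : ℝ → Ω → Prop := fun β ω => ∃ B : ℝ≥0, ∀ n, ∀ s ∈ S n ∪ S (n + 1),
    ∀ t ∈ S n ∪ S (n + 1), edist s t ≤ 4 * (R * (2⁻¹ : ℝ≥0∞) ^ n) →
      edist (X s ω) (X t ω) ≤ B * ((2⁻¹ : ℝ≥0∞) ^ β) ^ n with hGood
  have hmono : ∀ β β' ω, β ≤ β' → Good β' ω → Good β ω := by
    rintro β β' ω hle ⟨B, hB⟩
    refine ⟨B, fun n s hs t ht hst => (hB n s hs t ht hst).trans ?_⟩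
    refine mul_le_mul' le_rfl (pow_le_pow_left' ?_ n)
    exact ENNReal.rpow_le_rpow_of_exponent_ge (by simp) hle
  have hae : ∀ᵐ ω ∂P, ∀ β : ℝ, β < (q - d) / p → Good β ω := by
    have h1 : ∀ᵐ ω ∂P, ∀ b : ℚ, (b : ℝ) < (q - d) / p → Good b ω := by
      rw [ae_all_iff]
      intro b
      by_cases hb : (b : ℝ) < (q - d) / p
      · filter_upwards [kc_prob (R := R) hd hp hq hX hScard hb] with ω hω _ using hω
      · exact Eventually.of_forall fun ω h => absurd h hb
    filter_upwards [h1] with ω hω β hβ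
    obtain ⟨b, hb1, hb2⟩ := exists_rat_btwn hβ
    exact hmono _ _ _ hb1.le (hω b hb2)
  have hpos : 0 < (q - d) / p := div_pos (by linarith) hp
  have hlim : ∀ ω, (∀ β : ℝ, β < (q - d) / p → Good β ω) →
      ∀ t, ∃ l, Tendsto (fun n => X (π n t) ω) atTop (𝓝 l) := by
    intro ω hω t
    obtain ⟨B, hB⟩ := hω ((q - d) / p / 2) (by linarith)
    exact cauchySeq_tendsto_of_complete (cauchySeq_of_edist_le_geometric _ B
      (kc_g_lt (half_pos hpos)) (by simp)
      (fun n => kc_step (f := fun t => X t ω) hπS hπ hB t n))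
  have hY : ∀ ω, ∃ y : T → E,
      ((∀ β : ℝ, β < (q - d) / p → Good β ω) →
        ∀ t, Tendsto (fun n => X (π n t) ω) atTop (𝓝 (y t)) ∧
          (Tendsto (fun n => X (π n t) ω) atTop (𝓝 (X t ω)) → y t = X t ω)) ∧
      (¬ (∀ β : ℝ, β < (q - d) / p → Good β ω) → ∀ t, y t = x0) := by
    intro ω
    by_cases h : ∀ β : ℝ, β < (q - d) / p → Good β ω
    · choose L hL using hlim ω h
      refine ⟨fun t => if Tendsto (fun n => X (π n t) ω) atTop (𝓝 (X t ω)) then X t ω else L t,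
        fun _ t => ?_, fun h' => absurd h h'⟩
      by_cases ht : Tendsto (fun n => X (π n t) ω) atTop (𝓝 (X t ω))
      · simp [ht]
      · simp [ht, hL t]
    · exact ⟨fun _ => x0, fun h' => absurd h' h, fun _ _ => rfl⟩
  choose Y hY1 hY2 using hY
  refine ⟨fun t ω => Y ω t, fun t => ?_, fun β hβ0 hβ ω => ?_⟩
  · filter_upwards [hae, kc_modif hp (hd.trans hq) hX (fun n => hπ n t)] with ω h1 h2
    exact (hY1 ω h1 t).2 h2
  · by_cases h : ∀ β : ℝ, β < (q - d) / p → Good β ω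
    · obtain ⟨B, hB⟩ := h β hβ
      exact kc_holder (f := fun t => X t ω) hR hβ0 hRT hπS hπ hB (fun t => (hY1 ω h t).1)
    · exact ⟨0, fun s t => by simp [hY2 ω h]⟩
end

section
/- Localized Kolmogorov–Chentsov theorem: Let T be a second-countable extended pseudo-metric space covered by an increasing sequence of totally bounded open subsets (T_n)_{n∈ℕ} such that each T_n has bounded covering number with constant c_n > 0 and the same exponent d > 0. Let E be a complete extended pseudo-metric space, and let (p_m, q_m)_{m∈ℕ} be a sequence of pairs of positive reals with q_m > d for all m. If the process (X_t)_{t∈T} satisfies the Kolmogorov condition for exponents (p_m, q_m) for every m ∈ ℕ (with some finite constant for each m), then X has a modification Y whose paths are locally Hölder continuous of every order γ ∈ (0, sup_m (q_m − d)/p_m). -/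
open MeasureTheory ENNReal NNReal Set

theorem kc_scale {T Ω E : Type*} [PseudoEMetricSpace T] [PseudoEMetricSpace E]
    [MeasurableSpace Ω] {X : T → Ω → E} {P : Measure Ω} {p q : ℝ} {M : ℝ≥0}
    (hp : 0 < p) (hq : 0 < q) (hX : IsKolmogorovProcess X P p q M)
    (J : Finset T) (n : ℕ) (c : ℝ≥0∞) (hJ : (J.card : ℝ≥0∞) ≤ 2 ^ n) :
    ∃ Z : Ω → ℝ≥0∞, Measurable Z ∧
      (∀ ω, ∀ s ∈ J, ∀ t ∈ J, edist s t ≤ c → edist (X s ω) (X t ω) ^ p ≤ Z ω) ∧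
      ∫⁻ ω, Z ω ∂P ≤ 2 ^ p * (2 * J.card * (M * (n * c) ^ q)) := by
  obtain ⟨K, -, hK2, hK3, hK4⟩ := EMetric.pair_reduction hJ c E
  have hmeas : ∀ s t, Measurable fun ω => edist (X s ω) (X t ω) := by
    intro s t
    borelize (E × E)
    exact continuous_edist.measurable.comp (hX.1 s t)
  refine ⟨fun ω => 2 ^ p * ∑ x ∈ K, edist (X x.1 ω) (X x.2 ω) ^ p, ?_, ?_, ?_⟩
  · exact (Finset.measurable_sum _ fun x _ => (hmeas _ _).pow_const p).const_mul _
  · intro ω s hs t ht hst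
    have h := hK4 (fun t => X t ω)
    have h1 : edist (X s ω) (X t ω) ≤
        ⨆ (s : J) (t : { t : J // edist (s : T) t ≤ c}), edist (X s ω) (X t ω) :=
      le_iSup_of_le ⟨s, hs⟩ (le_iSup_of_le ⟨⟨t, ht⟩, hst⟩ le_rfl)
    have h2 := h1.trans h
    have h3 : (⨆ x : K, edist (X x.1.1 ω) (X x.1.2 ω)) ≤
        (∑ x ∈ K, edist (X x.1 ω) (X x.2 ω) ^ p) ^ (1 / p) := by
      refine iSup_le fun x => ?_
      rw [one_div, ENNReal.le_rpow_inv_iff hp]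
      exact Finset.single_le_sum (f := fun x : T × T => edist (X x.1 ω) (X x.2 ω) ^ p)
        (fun _ _ => zero_le) x.2
    calc edist (X s ω) (X t ω) ^ p
        ≤ (2 * (∑ x ∈ K, edist (X x.1 ω) (X x.2 ω) ^ p) ^ (1 / p)) ^ p := by
          gcongr; exact h2.trans (by gcongr)
      _ = _ := by
          rw [ENNReal.mul_rpow_of_nonneg _ _ hp.le, ← ENNReal.rpow_mul,
            one_div_mul_cancel hp.ne', ENNReal.rpow_one]
  · rw [lintegral_const_mul _ (Finset.measurable_sum _ fun x _ => (hmeas _ _).pow_const p),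
      lintegral_finsetSum _ fun x _ => (hmeas _ _).pow_const p]
    gcongr
    calc ∑ x ∈ K, ∫⁻ ω, edist (X x.1 ω) (X x.2 ω) ^ p ∂P
        ≤ ∑ x ∈ K, (M * (n * c) ^ q : ℝ≥0∞) := by
          refine Finset.sum_le_sum fun x hx => (hX.2 _ _).trans ?_
          gcongr
          exact hK3 _ _ hx
      _ = K.card * (M * (n * c) ^ q : ℝ≥0∞) := by simp
      _ ≤ _ := by gcongr

theorem kc_summable (q r : ℝ≥0) (hr : r < 1) :
    Summable fun k : ℕ => ((k : ℝ≥0) + 1) ^ (q : ℝ) * r ^ k := by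
  obtain ⟨N, hN⟩ := exists_nat_ge q
  rcases eq_or_ne r 0 with rfl | hr0
  · refine summable_of_ne_finset_zero (s := {0}) fun b hb => ?_
    simp at hb; simp [hb]
  have h1 : Summable fun k : ℕ => (k : ℝ) ^ N * (r : ℝ) ^ k :=
    summable_pow_mul_geometric_of_norm_lt_one N (by simpa using hr)
  have h2 : Summable fun k : ℕ => (k : ℝ≥0) ^ N * r ^ k := by
    rw [← NNReal.summable_coe]; simpa using h1
  have h3 := ((NNReal.summable_nat_add_iff 1).2 h2).mul_left r⁻¹
  refine NNReal.summable_of_le (fun k => ?_) h3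
  have : ((k : ℝ≥0) + 1) ^ (q : ℝ) ≤ ((k : ℝ≥0) + 1) ^ N := by
    rw [← NNReal.rpow_natCast]
    exact NNReal.rpow_le_rpow_of_exponent_le (by simp) (by exact_mod_cast hN)
  calc ((k : ℝ≥0) + 1) ^ (q : ℝ) * r ^ k ≤ ((k : ℝ≥0) + 1) ^ N * r ^ k := by gcongr
    _ = _ := by push_cast; field_simp; ring

open Filter Topology in
theorem kc_chain {T E : Type*} [PseudoEMetricSpace T] [PseudoEMetricSpace E]
    (A : Set T) (δ : ℝ≥0) (S : ℕ → Finset T) (π : ℕ → T → T)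
    (hπS : ∀ k, ∀ t ∈ A, π k t ∈ S k)
    (hπ : ∀ k, ∀ t ∈ A, edist t (π k t) ≤ δ * (2⁻¹ : ℝ≥0) ^ k)
    (f : T → E) (C g : ℝ≥0)
    (hf : ∀ k, ∀ s ∈ S k, ∀ t, (t ∈ S k ∨ t ∈ S (k + 1)) →
      edist s t ≤ 4 * (δ * (2⁻¹ : ℝ≥0) ^ k) → edist (f s) (f t) ≤ C * g ^ k)
    (k : ℕ) (t : T) (ht : t ∈ A) : edist (f (π k t)) (f (π (k + 1) t)) ≤ C * g ^ k := by
  classical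
  refine hf k _ (hπS k t ht) _ (Or.inr (hπS _ t ht)) ?_
  have h2 : (2⁻¹ : ℝ≥0) ^ (k + 1) ≤ 2⁻¹ ^ k :=
    pow_le_pow_of_le_one zero_le (by norm_num) (Nat.le_succ k)
  calc edist (π k t) (π (k + 1) t) ≤ edist t (π k t) + edist t (π (k + 1) t) :=
        edist_triangle_left _ _ _
    _ ≤ δ * (2⁻¹ : ℝ≥0) ^ k + δ * (2⁻¹ : ℝ≥0) ^ (k + 1) := add_le_add (hπ _ _ ht) (hπ _ _ ht)
    _ ≤ 4 * (δ * (2⁻¹ : ℝ≥0) ^ k) := by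
      norm_cast
      have := mul_le_mul_right h2 δ
      calc _ ≤ δ * 2⁻¹ ^ k + δ * 2⁻¹ ^ k := by gcongr
        _ = 2 * (δ * 2⁻¹ ^ k) := by ring
        _ ≤ _ := by gcongr; norm_num

open Filter Topology in
theorem kc_holder_s6 {T E : Type*} [PseudoEMetricSpace T] [PseudoEMetricSpace E]
    (A : Set T) (δ : ℝ≥0) (hδ : 0 < δ) (hA : ∀ s ∈ A, ∀ t ∈ A, edist s t ≤ δ)
    (S : ℕ → Finset T) (π : ℕ → T → T)
    (hπS : ∀ k, ∀ t ∈ A, π k t ∈ S k)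
    (hπ : ∀ k, ∀ t ∈ A, edist t (π k t) ≤ δ * (2⁻¹ : ℝ≥0) ^ k)
    (f : T → E) (C γ : ℝ≥0) (hγ : 0 < γ)
    (hf : ∀ k, ∀ s ∈ S k, ∀ t, (t ∈ S k ∨ t ∈ S (k + 1)) →
      edist s t ≤ 4 * (δ * (2⁻¹ : ℝ≥0) ^ k) →
        edist (f s) (f t) ≤ C * ((2⁻¹ : ℝ≥0) ^ (γ : ℝ) : ℝ≥0) ^ k)
    (y : T → E) (hy : ∀ t ∈ A, Tendsto (fun k => f (π k t)) atTop (𝓝 (y t))) :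
    ∃ C' : ℝ≥0, HolderOnWith C' γ y A := by
  set g : ℝ≥0 := (2⁻¹ : ℝ≥0) ^ (γ : ℝ) with hg
  have hg1 : g < 1 := NNReal.rpow_lt_one (by norm_num) (by exact_mod_cast hγ)
  have hlim : ∀ t ∈ A, ∀ k, edist (f (π k t)) (y t) ≤ C * g ^ k / (1 - g) := fun t ht k =>
    edist_le_of_edist_le_geometric_of_tendsto _ _
      (fun k => kc_chain A δ S π hπS hπ f C g hf k t ht) (hy t ht) k
  set C2 : ℝ≥0 := C / (1 - g) + C / (1 - g) + C with hC2
  have key : ∀ s ∈ A, ∀ t ∈ A, ∀ k : ℕ, edist s t ≤ δ * (2⁻¹ : ℝ≥0) ^ k →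
      edist (y s) (y t) ≤ (C2 * g ^ k : ℝ≥0) := by
    intro s hs t ht k hst
    have h1 : edist (f (π k s)) (f (π k t)) ≤ C * g ^ k := by
      refine hf k _ (hπS k s hs) _ (Or.inl (hπS k t ht)) ?_
      calc edist (π k s) (π k t) ≤ edist (π k s) s + edist s t + edist t (π k t) :=
            edist_triangle4 _ _ _ _
        _ ≤ δ * (2⁻¹ : ℝ≥0) ^ k + δ * (2⁻¹ : ℝ≥0) ^ k + δ * (2⁻¹ : ℝ≥0) ^ k := by
            gcongr
            · rw [edist_comm]; exact hπ k s hs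
            · exact hπ k t ht
        _ ≤ 4 * (δ * (2⁻¹ : ℝ≥0) ^ k) := by
            norm_cast
            calc _ = 3 * (δ * 2⁻¹ ^ k) := by ring
              _ ≤ _ := by gcongr; norm_num
    calc edist (y s) (y t) ≤ edist (y s) (f (π k s)) + edist (f (π k s)) (f (π k t))
          + edist (f (π k t)) (y t) := edist_triangle4 _ _ _ _
      _ ≤ C * g ^ k / (1 - g) + C * g ^ k + C * g ^ k / (1 - g) := by
          gcongr
          · rw [edist_comm]; exact hlim s hs k
          · exact hlim t ht k
      _ = (C2 * g ^ k : ℝ≥0) := by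
          have h0 : (1 - g : ℝ≥0) ≠ 0 := (tsub_pos_of_lt hg1).ne'
          rw [← ENNReal.coe_one, ← ENNReal.coe_sub, ← ENNReal.coe_pow, ← ENNReal.coe_mul,
            ← ENNReal.coe_div h0, ← ENNReal.coe_add, ← ENNReal.coe_add, hC2]
          congr 1
          ring
  refine ⟨C2 * (2 / δ) ^ (γ : ℝ), fun s hs t ht => ?_⟩
  have hfin : edist s t ≠ ⊤ := ne_top_of_le_ne_top ENNReal.coe_ne_top (hA s hs t ht)
  obtain ⟨x, hx⟩ : ∃ x : ℝ≥0, (x : ℝ≥0∞) = edist s t := ⟨_, ENNReal.coe_toNNReal hfin⟩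
  have hxδ : x ≤ δ := by have := hA s hs t ht; rw [← hx] at this; exact_mod_cast this
  rcases eq_or_ne x 0 with rfl | hx0
  · have h0 : Tendsto (fun k : ℕ => ((C2 * g ^ k : ℝ≥0) : ℝ≥0∞)) atTop (𝓝 ((C2 * 0 : ℝ≥0))) :=
      ENNReal.tendsto_coe.2 ((NNReal.tendsto_pow_atTop_nhds_zero_of_lt_one hg1).const_mul C2)
    have : edist (y s) (y t) ≤ ((C2 * 0 : ℝ≥0) : ℝ≥0∞) :=
      ge_of_tendsto' h0 fun k => key s hs t ht k (by rw [← hx]; simp)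
    refine this.trans (by simp)
  · obtain ⟨k, hk1, hk2⟩ := exists_nat_pow_near_of_lt_one (x := x / δ) (y := (2⁻¹ : ℝ≥0))
      (by positivity) (div_le_one_of_le₀ hxδ zero_le) (by norm_num) (by norm_num)
    refine (key s hs t ht k ?_).trans ?_
    · rw [← hx]
      norm_cast
      rw [div_le_iff₀ hδ] at hk2
      rw [mul_comm]; exact_mod_cast hk2
    · rw [← hx, ← ENNReal.coe_rpow_of_nonneg _ (NNReal.coe_nonneg γ)]
      norm_cast
      rw [mul_assoc, ← NNReal.mul_rpow, hg]
      gcongr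
      rw [← NNReal.rpow_natCast, ← NNReal.rpow_mul, mul_comm, NNReal.rpow_mul, NNReal.rpow_natCast]
      gcongr
      calc (2⁻¹ : ℝ≥0) ^ k = 2 * 2⁻¹ ^ (k + 1) := by rw [pow_succ]; field_simp
        _ ≤ 2 * (x / δ) := by gcongr
        _ = _ := by ring

theorem kc_ae {T Ω E : Type*} [PseudoEMetricSpace T] [PseudoEMetricSpace E]
    [MeasurableSpace Ω] {X : T → Ω → E} {P : Measure Ω} {p q d : ℝ} {M : ℝ≥0} (hd : 0 < d)
    (hp : 0 < p) (hq : 0 < q) (hX : IsKolmogorovProcess X P p q M)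
    (δ : ℝ≥0) (hδ : 0 < δ) (S : ℕ → Finset T) (c : ℝ≥0)
    (hS : ∀ k, ((S k).card : ℝ≥0∞) ≤ c * ((δ * 2⁻¹ ^ k : ℝ≥0) : ℝ≥0∞) ^ (-d))
    (γ : ℝ≥0) (hγ : (γ : ℝ) < (q - d) / p) :
    ∀ᵐ ω ∂P, ∃ C : ℝ≥0, ∀ k, ∀ s ∈ S k, ∀ t, (t ∈ S k ∨ t ∈ S (k + 1)) →
      edist s t ≤ 4 * (δ * (2⁻¹ : ℝ≥0) ^ k) →
        edist (X s ω) (X t ω) ≤ C * ((2⁻¹ : ℝ≥0) ^ (γ : ℝ) : ℝ≥0) ^ k := by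
  classical
  set R : ℝ≥0 := 2 ^ d with hR
  set c0 : ℝ≥0 := c * δ ^ (-d) with hc0
  have hS' : ∀ k, ((S k).card : ℝ≥0) ≤ c0 * R ^ k := by
    intro k
    have h := hS k
    rw [← ENNReal.coe_rpow_of_ne_zero (by positivity)] at h
    have h' : ((S k).card : ℝ≥0) ≤ c * (δ * 2⁻¹ ^ k) ^ (-d) := by exact_mod_cast h
    refine h'.trans (le_of_eq ?_)
    rw [NNReal.mul_rpow, hc0, hR, mul_assoc]
    congr 2
    rw [← NNReal.rpow_natCast, ← NNReal.rpow_natCast, ← NNReal.rpow_mul, ← NNReal.rpow_mul,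
      NNReal.inv_rpow, ← NNReal.rpow_neg]
    congr 1; ring
  set c1 : ℝ≥0 := c0 * (1 + R) with hc1
  set J : ℕ → Finset T := fun k => S k ∪ S (k + 1) with hJdef
  have hJ : ∀ k, ((J k).card : ℝ≥0) ≤ c1 * R ^ k := by
    intro k
    calc ((J k).card : ℝ≥0) ≤ (S k).card + (S (k + 1)).card := by
          exact_mod_cast Finset.card_union_le _ _
      _ ≤ c0 * R ^ k + c0 * R ^ (k + 1) := add_le_add (hS' _) (hS' _)
      _ = _ := by rw [hc1]; ring
  obtain ⟨L, hL⟩ := pow_unbounded_of_one_lt (max c1 R) (one_lt_two : (1 : ℝ≥0) < 2)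
  have hJ2 : ∀ k, ((J k).card : ℝ≥0∞) ≤ 2 ^ (L * (k + 1)) := by
    intro k
    have : ((J k).card : ℝ≥0) ≤ 2 ^ (L * (k + 1)) := by
      refine (hJ k).trans ?_
      rw [pow_mul, pow_succ, mul_comm]
      exact mul_le_mul' (pow_le_pow_left₀ zero_le ((le_max_right _ _).trans hL.le) _)
        ((le_max_left _ _).trans hL.le)
    exact_mod_cast this
  have hscale := fun k => kc_scale hp hq hX (J k) (L * (k + 1)) (4 * (δ * (2⁻¹ : ℝ≥0) ^ k)) (hJ2 k)
  choose Z hZm hZ hZi using hscale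
  set G : ℝ≥0 := 2 ^ ((γ : ℝ) * p) with hG
  set r : ℝ≥0 := R * 2⁻¹ ^ q * G with hr
  have hr1 : r < 1 := by
    rw [hr, hR, hG, NNReal.inv_rpow, ← NNReal.rpow_neg, ← NNReal.rpow_add two_ne_zero,
      ← NNReal.rpow_add two_ne_zero]
    refine NNReal.rpow_lt_one_of_one_lt_of_neg one_lt_two ?_
    rw [lt_div_iff₀ hp] at hγ
    linarith
  set K0 : ℝ≥0 := 2 ^ p * (2 * c1 * (M * (L * 4 * δ) ^ q)) with hK0
  have hint : ∀ k, ∫⁻ ω, Z k ω * (G : ℝ≥0∞) ^ k ∂P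
      ≤ ((K0 * (((k : ℝ≥0) + 1) ^ q * r ^ k) : ℝ≥0) : ℝ≥0∞) := by
    intro k
    rw [lintegral_mul_const _ (hZm k)]
    have e1 : ((L * (k + 1) : ℕ) : ℝ≥0∞) * (4 * (δ * (2⁻¹ : ℝ≥0) ^ k))
        = ((L * 4 * δ * ((k + 1) * 2⁻¹ ^ k) : ℝ≥0) : ℝ≥0∞) := by
      push_cast; ring
    have e2 : (2⁻¹ ^ q) ^ k = ((2⁻¹ : ℝ≥0) ^ k) ^ q := by
      rw [← NNReal.rpow_natCast, ← NNReal.rpow_natCast, ← NNReal.rpow_mul, ← NNReal.rpow_mul,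
        mul_comm]
    calc (∫⁻ ω, Z k ω ∂P) * (G : ℝ≥0∞) ^ k
        ≤ ((2 ^ p * (2 * (c1 * R ^ k) * (M * (L * 4 * δ * ((k + 1) * 2⁻¹ ^ k)) ^ q)) * G ^ k :
            ℝ≥0) : ℝ≥0∞) := by
          rw [ENNReal.coe_mul, ENNReal.coe_pow]
          gcongr
          refine (hZi k).trans ?_
          rw [e1, ← ENNReal.coe_rpow_of_nonneg _ hq.le, ENNReal.coe_mul,
            ENNReal.coe_rpow_of_nonneg _ hp.le, ENNReal.coe_mul (2 * _), ENNReal.coe_mul 2,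
            ENNReal.coe_mul M]
          gcongr
          · norm_num
          · norm_num
          · exact_mod_cast hJ k
      _ = _ := by
          congr 1
          rw [hK0, hr, mul_pow, mul_pow, e2, NNReal.mul_rpow (x := L * 4 * δ), NNReal.mul_rpow (x := (k : ℝ≥0) + 1)]
          ring
  have hsum : ∑' k, ∫⁻ ω, Z k ω * (G : ℝ≥0∞) ^ k ∂P ≠ ⊤ := by
    refine ne_top_of_le_ne_top ?_ (ENNReal.tsum_le_tsum hint)
    rw [ENNReal.tsum_coe_ne_top_iff_summable]
    exact (kc_summable ⟨q, hq.le⟩ r hr1).mul_left K0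
  rw [← lintegral_tsum fun k => ((hZm k).mul_const _).aemeasurable] at hsum
  have hae := ae_lt_top' (AEMeasurable.tsum fun k => ((hZm k).mul_const _).aemeasurable) hsum
  filter_upwards [hae] with ω hω
  obtain ⟨B, hB⟩ : ∃ B : ℝ≥0, (B : ℝ≥0∞) = _ := ⟨_, ENNReal.coe_toNNReal hω.ne⟩
  refine ⟨B ^ (1 / p), fun k s hs t ht hst => ?_⟩
  have h1 := hZ k ω s (Finset.mem_union_left _ hs) t (Finset.mem_union.2 ht) hst
  have h2 : Z k ω * (G : ℝ≥0∞) ^ k ≤ B := by rw [hB]; exact ENNReal.le_tsum k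
  have hG0 : (G : ℝ≥0∞) ^ k ≠ 0 := by
    have : 0 < G := by rw [hG]; positivity
    exact pow_ne_zero _ (by exact_mod_cast this.ne')
  rw [← ENNReal.le_div_iff_mul_le (Or.inl hG0) (Or.inl (by simp))] at h2
  rw [← ENNReal.rpow_le_rpow_iff hp]
  refine (h1.trans h2).trans (le_of_eq ?_)
  rw [ENNReal.mul_rpow_of_nonneg _ _ hp.le, div_eq_mul_inv]
  have hG0' : G ^ k ≠ 0 := by exact_mod_cast hG0
  rw [← ENNReal.coe_pow, ← ENNReal.coe_pow, ← ENNReal.coe_inv hG0',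
    ← ENNReal.coe_rpow_of_nonneg _ hp.le, ← ENNReal.coe_rpow_of_nonneg _ hp.le, ← NNReal.rpow_mul,
    one_div_mul_cancel hp.ne', NNReal.rpow_one]
  congr 2
  rw [hG, ← NNReal.rpow_natCast, ← NNReal.rpow_natCast, ← NNReal.rpow_mul, ← NNReal.rpow_mul,
    ← NNReal.rpow_mul, NNReal.inv_rpow]
  congr 2
  ring

open Filter Topology in
theorem kc_local {T Ω E : Type*} [PseudoEMetricSpace T]
    [MeasurableSpace Ω] [PseudoEMetricSpace E] [CompleteSpace E]
    {P : Measure Ω} {X : T → Ω → E}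
    {d : ℝ} (hd : 0 < d) (A : Set T) (c : ℝ≥0)
    (hcov : HasBoundedInternalCoveringNumber A c d)
    (p q : ℕ → ℝ) (hp : ∀ m, 0 < p m) (hq : ∀ m, d < q m)
    (M : ℕ → ℝ≥0) (hX : ∀ m, IsKolmogorovProcess X P (p m) (q m) (M m)) :
    ∃ Y : T → Ω → E,
      (∀ t ∈ A, ∀ᵐ ω ∂P, edist (Y t ω) (X t ω) = 0) ∧
      ∀ᵐ ω ∂P, ∀ γ : ℝ≥0, 0 < γ → (∃ m, (γ : ℝ) < (q m - d) / p m) →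
        ∃ C : ℝ≥0, HolderOnWith C γ (fun t => Y t ω) A := by
  classical
  have hmeas : ∀ s t, Measurable fun ω => edist (X s ω) (X t ω) := by
    intro s t
    borelize (E × E)
    exact continuous_edist.measurable.comp ((hX 0).1 s t)
  have hq0 : ∀ m, 0 < q m := fun m => hd.trans (hq m)
  rcases A.eq_empty_or_nonempty with rfl | ⟨t0, ht0⟩
  · exact ⟨X, by simp, Eventually.of_forall fun ω γ _ _ => ⟨0, by simp⟩⟩
  have hAd : ∀ s ∈ A, ∀ t ∈ A, edist s t ≤ Metric.ediam A := fun s hs t ht =>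
    Metric.edist_le_ediam_of_mem hs ht
  rcases eq_or_ne (Metric.ediam A) 0 with h0 | h0
  · refine ⟨fun _ => X t0, fun t ht => ?_, Eventually.of_forall fun ω γ _ _ => ⟨0, fun s _ t _ => by simp⟩⟩
    have h1 : ∫⁻ ω, edist (X t0 ω) (X t ω) ^ p 0 ∂P = 0 := by
      refine le_antisymm (((hX 0).2 t0 t).trans ?_) zero_le
      have : edist t0 t = 0 := le_antisymm (h0 ▸ hAd t0 ht0 t ht) zero_le
      simp [this, hq0 0]
    rw [lintegral_eq_zero_iff ((hmeas _ _).pow_const _)] at h1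
    filter_upwards [h1] with ω hω
    simpa [hp 0, (hp 0).not_gt] using hω
  have htop : Metric.ediam A ≠ ⊤ := by
    intro htop
    obtain ⟨S, -, hS2, hS3⟩ := hcov ⊤ (by simp) (le_of_eq htop.symm)
    rw [ENNReal.top_rpow_of_neg (by linarith), mul_zero] at hS3
    obtain ⟨s, hs, -⟩ := hS2 t0 ht0
    have : S.card = 0 := by exact_mod_cast le_antisymm hS3 zero_le
    rw [Finset.card_eq_zero] at this
    simp [this] at hs
  obtain ⟨δ, hδ⟩ : ∃ δ : ℝ≥0, (δ : ℝ≥0∞) = Metric.ediam A := ⟨_, ENNReal.coe_toNNReal htop⟩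
  rw [← hδ] at hAd
  have hδ0 : 0 < δ := by
    rw [pos_iff_ne_zero]; rintro rfl; exact h0 (by rw [← hδ]; simp)
  have hnet : ∀ k : ℕ, ∃ S : Finset T, (∀ t ∈ A, ∃ s ∈ S, edist t s ≤ (δ * 2⁻¹ ^ k : ℝ≥0)) ∧
      (S.card : ℝ≥0∞) ≤ c * ((δ * 2⁻¹ ^ k : ℝ≥0) : ℝ≥0∞) ^ (-d) := by
    intro k
    obtain ⟨S, -, hS2, hS3⟩ := hcov ((δ * 2⁻¹ ^ k : ℝ≥0) : ℝ≥0∞)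
      (by have : 0 < δ * 2⁻¹ ^ k := by positivity
          exact_mod_cast this)
      (by
        have : δ * 2⁻¹ ^ k ≤ δ := mul_le_of_le_one_right zero_le
          (pow_le_one₀ zero_le (by norm_num))
        refine le_trans ?_ (le_of_eq hδ)
        exact_mod_cast this)
    exact ⟨S, hS2, hS3⟩
  choose S hSc hScard using hnet
  have hπex : ∀ k t, ∃ s, t ∈ A → s ∈ S k ∧ edist t s ≤ (δ * 2⁻¹ ^ k : ℝ≥0) := by
    intro k t
    by_cases ht : t ∈ A
    · obtain ⟨s, h1, h2⟩ := hSc k t ht; exact ⟨s, fun _ => ⟨h1, h2⟩⟩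
    · exact ⟨t, fun h => absurd h ht⟩
  choose π hπ' using hπex
  have hπS : ∀ k, ∀ t ∈ A, π k t ∈ S k := fun k t ht => (hπ' k t ht).1
  have hπ : ∀ k, ∀ t ∈ A, edist t (π k t) ≤ δ * (2⁻¹ : ℝ≥0) ^ k := fun k t ht => by
    have := (hπ' k t ht).2
    rwa [ENNReal.coe_mul, ENNReal.coe_pow] at this
  -- the limit
  let Y : T → Ω → E := fun t ω =>
    if h : ∃ y, Tendsto (fun k => X (π k t) ω) atTop (𝓝 y) then h.choose else X t ω
  have hYlim : ∀ t ω, (∃ y, Tendsto (fun k => X (π k t) ω) atTop (𝓝 y)) →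
      Tendsto (fun k => X (π k t) ω) atTop (𝓝 (Y t ω)) := by
    intro t ω h
    simp only [Y, dif_pos h]
    exact h.choose_spec
  refine ⟨Y, fun t ht => ?_, ?_⟩
  · -- convergence to `X t`
    have hq1 : (2⁻¹ : ℝ≥0) ^ q 0 < 1 := NNReal.rpow_lt_one (by norm_num) (hq0 0)
    have hint : ∀ k, ∫⁻ ω, edist (X t ω) (X (π k t) ω) ^ p 0 ∂P ≤
        ((M 0 * δ ^ q 0 * ((2⁻¹ : ℝ≥0) ^ q 0) ^ k : ℝ≥0) : ℝ≥0∞) := by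
      intro k
      refine ((hX 0).2 _ _).trans ?_
      calc (M 0 : ℝ≥0∞) * edist t (π k t) ^ q 0 ≤ M 0 * ((δ * 2⁻¹ ^ k : ℝ≥0) : ℝ≥0∞) ^ q 0 := by
            have := (hq0 0).le
            gcongr
            exact (hπ' k t ht).2
        _ = _ := by
            rw [← ENNReal.coe_rpow_of_nonneg _ (hq0 0).le, ← ENNReal.coe_mul, NNReal.mul_rpow,
              mul_assoc]
            congr 3
            rw [← NNReal.rpow_natCast, ← NNReal.rpow_natCast, ← NNReal.rpow_mul,
              ← NNReal.rpow_mul, mul_comm]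
    have hsum : ∑' k, ∫⁻ ω, edist (X t ω) (X (π k t) ω) ^ p 0 ∂P ≠ ⊤ := by
      refine ne_top_of_le_ne_top ?_ (ENNReal.tsum_le_tsum hint)
      rw [ENNReal.tsum_coe_ne_top_iff_summable]
      exact (NNReal.summable_geometric hq1).mul_left _
    have hm : ∀ k, AEMeasurable (fun ω => edist (X t ω) (X (π k t) ω) ^ p 0) P :=
      fun k => ((hmeas _ _).pow_const _).aemeasurable
    rw [← lintegral_tsum hm] at hsum
    have hae := ae_lt_top' (AEMeasurable.tsum hm) hsum
    filter_upwards [hae] with ω hω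
    have h1 := ENNReal.tendsto_atTop_zero_of_tsum_ne_top hω.ne
    have h2 : Tendsto (fun k => edist (X (π k t) ω) (X t ω)) atTop (𝓝 0) := by
      have := (ENNReal.continuous_rpow_const (y := (p 0)⁻¹)).tendsto 0 |>.comp h1
      rw [ENNReal.zero_rpow_of_pos (inv_pos.2 (hp 0))] at this
      refine this.congr fun k => ?_
      simp only [Function.comp]
      rw [← ENNReal.rpow_mul, mul_inv_cancel₀ (hp 0).ne', ENNReal.rpow_one, edist_comm]
    have h3 : Tendsto (fun k => X (π k t) ω) atTop (𝓝 (X t ω)) :=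
      tendsto_iff_edist_tendsto_0.2 h2
    have h4 := hYlim t ω ⟨_, h3⟩
    have h5 := (h4.edist h3)
    simp only [edist_self] at h5
    exact tendsto_nhds_unique h5 tendsto_const_nhds
  · have hall : ∀ᵐ ω ∂P, ∀ m : ℕ, ∀ a : ℚ, (0 < a ∧ (a : ℝ) < (q m - d) / p m) →
        ∃ C : ℝ≥0, ∀ k, ∀ s ∈ S k, ∀ t, (t ∈ S k ∨ t ∈ S (k + 1)) →
        edist s t ≤ 4 * (δ * (2⁻¹ : ℝ≥0) ^ k) →
        edist (X s ω) (X t ω) ≤ C * ((2⁻¹ : ℝ≥0) ^ ((a : ℝ).toNNReal : ℝ) : ℝ≥0) ^ k := by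
      rw [ae_all_iff]; intro m
      rw [ae_all_iff]; intro a
      by_cases ha : (0 < a ∧ (a : ℝ) < (q m - d) / p m)
      · have ha0 : (0 : ℝ) ≤ a := by exact_mod_cast ha.1.le
        have := kc_ae hd (hp m) (hq0 m) (hX m) δ hδ0 S c hScard (a : ℝ).toNNReal
          (by rw [Real.coe_toNNReal _ ha0]; exact ha.2)
        filter_upwards [this] with ω hω _ using hω
      · exact Eventually.of_forall fun ω h => absurd h ha
    filter_upwards [hall] with ω hω γ hγ hm
    obtain ⟨m, hm⟩ := hm
    obtain ⟨a, ha1, ha2⟩ := exists_rat_btwn hm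
    have ha0 : (0 : ℝ) < a := lt_of_le_of_lt γ.2 ha1
    obtain ⟨C, hC⟩ := hω m a ⟨by exact_mod_cast ha0, ha2⟩
    have hapos : 0 < (a : ℝ).toNNReal := by simpa using ha0
    have hg1 : (2⁻¹ : ℝ≥0) ^ ((a : ℝ).toNNReal : ℝ) < 1 :=
      NNReal.rpow_lt_one (by norm_num) (by exact_mod_cast hapos)
    obtain ⟨C', hC'⟩ := kc_holder_s6 A δ hδ0 hAd S π hπS hπ (fun t => X t ω) C _ hapos hC
      (fun t => Y t ω) (fun t ht => hYlim t ω (by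
        have hc : CauchySeq fun k => X (π k t) ω :=
          cauchySeq_of_edist_le_geometric _ C (by exact_mod_cast hg1) ENNReal.coe_ne_top
            (fun k => kc_chain A δ S π hπS hπ (fun t => X t ω) C _ hC k t ht)
        exact cauchySeq_tendsto_of_complete hc))
    exact ⟨_, hC'.of_le hAd (by rw [← NNReal.coe_le_coe, Real.coe_toNNReal _ ha0.le]; exact ha1.le)⟩

/-- **Localized Kolmogorov–Chentsov theorem.** Let `T` be a second-countable pseudo-emetric
space covered by an increasing sequence of totally bounded open subsets `Tn` such that each
`Tn n` has bounded covering number with constant `cn n > 0` and the same exponent `d > 0`. Let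
`E` be a complete pseudo-emetric space and `(p m, q m)` a sequence of pairs of positive reals
with `q m > d`. If `X` satisfies the Kolmogorov condition for exponents `(p m, q m)` (with some
finite constant `M m`) for every `m`, then `X` has a modification `Y` whose paths are locally
Hölder continuous of every order `γ ∈ (0, ⨆ m, (q m - d) / p m)` (membership in that interval
being expressed as `0 < γ` and `γ < (q m - d) / p m` for some `m`). -/
theorem kolmogorov_chentsov_localized {T Ω E : Type*} [PseudoEMetricSpace T]
    [SecondCountableTopology T] [MeasurableSpace Ω] [PseudoEMetricSpace E] [CompleteSpace E]
    {P : Measure Ω} [IsProbabilityMeasure P] {X : T → Ω → E}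
    {d : ℝ} (hd : 0 < d)
    (Tn : ℕ → Set T) (hTn_open : ∀ n, IsOpen (Tn n)) (hTn_tb : ∀ n, TotallyBounded (Tn n))
    (hTn_mono : Monotone Tn) (hTn_cover : ⋃ n, Tn n = Set.univ)
    (cn : ℕ → ℝ≥0) (hcn : ∀ n, 0 < cn n)
    (hTn_cov : ∀ n, HasBoundedInternalCoveringNumber (Tn n) (cn n) d)
    (p q : ℕ → ℝ) (hp : ∀ m, 0 < p m) (hq_pos : ∀ m, 0 < q m) (hq : ∀ m, d < q m)
    (M : ℕ → ℝ≥0) (hX : ∀ m, IsKolmogorovProcess X P (p m) (q m) (M m)) :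
    ∃ Y : T → Ω → E,
      (∀ t, ∀ᵐ ω ∂P, Y t ω = X t ω) ∧
      ∀ ω (γ : ℝ≥0), 0 < γ → (∃ m, (γ : ℝ) < (q m - d) / p m) →
        ∀ t : T, ∃ U ∈ nhds t, ∃ C : ℝ≥0, HolderOnWith C γ (fun t => Y t ω) U := by

  classical
  rcases isEmpty_or_nonempty T with hT | ⟨⟨t0⟩⟩
  · exact ⟨X, fun t => isEmptyElim t, fun _ _ _ _ t => isEmptyElim t⟩
  choose Z hZ1 hZ2 using fun n => kc_local hd (Tn n) (cn n) (hTn_cov n) p q hp hq M hX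
  obtain ⟨D, hDc, hDd⟩ := TopologicalSpace.exists_countable_dense T
  have hmem : ∀ t, ∃ n, t ∈ Tn n := fun t => by
    have : t ∈ ⋃ n, Tn n := hTn_cover ▸ mem_univ t
    simpa using this
  choose N hN using hmem
  -- the good event
  let Good : Ω → Prop := fun ω =>
    (∀ n, ∀ γ : ℝ≥0, 0 < γ → (∃ m, (γ : ℝ) < (q m - d) / p m) →
        ∃ C : ℝ≥0, HolderOnWith C γ (fun t => Z n t ω) (Tn n)) ∧
    ∀ n, ∀ t ∈ D, t ∈ Tn n → edist (Z n t ω) (X t ω) = 0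
  have hGood : ∀ᵐ ω ∂P, Good ω := by
    refine Filter.Eventually.and (ae_all_iff.2 hZ2) (ae_all_iff.2 fun n => ?_)
    rw [ae_ball_iff hDc]
    intro t _
    by_cases ht : t ∈ Tn n
    · filter_upwards [hZ1 n t ht] with ω hω _ using hω
    · exact Filter.Eventually.of_forall fun ω h => absurd h ht
  let Y0 : T → Ω → E := fun t ω => if Good ω then Z (N t) t ω else X t0 ω
  let Y : T → Ω → E := fun t ω => if edist (Y0 t ω) (X t ω) = 0 then X t ω else Y0 t ω
  have hY0 : ∀ t ω, edist (Y t ω) (Y0 t ω) = 0 := by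
    intro t ω
    by_cases h : edist (Y0 t ω) (X t ω) = 0
    · simp only [Y, if_pos h]; rw [edist_comm]; exact h
    · simp only [Y, if_neg h, edist_self]
  refine ⟨Y, fun t => ?_, fun ω γ hγ hm t => ?_⟩
  · filter_upwards [hGood, hZ1 (N t) t (hN t)] with ω h1 h2
    have : edist (Y0 t ω) (X t ω) = 0 := by simp only [Y0, if_pos h1]; exact h2
    simp only [Y, if_pos this]
  · have hYY : ∀ s s', edist (Y s ω) (Y s' ω) ≤ edist (Y0 s ω) (Y0 s' ω) := fun s s' =>
      calc edist (Y s ω) (Y s' ω) ≤ edist (Y s ω) (Y0 s ω) + edist (Y0 s ω) (Y0 s' ω)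
            + edist (Y0 s' ω) (Y s' ω) := edist_triangle4 _ _ _ _
        _ = _ := by rw [hY0, edist_comm (Y0 s' ω), hY0]; simp
    by_cases hω : Good ω
    · have hcont : ∀ n, ContinuousOn (fun t => Z n t ω) (Tn n) := fun n => by
        obtain ⟨C, hC⟩ := hω.1 n γ hγ hm
        exact hC.continuousOn hγ
      have hcons : ∀ n, ∀ s ∈ Tn n, edist (Y0 s ω) (Z n s ω) = 0 := by
        intro n s hs
        have hY0s : Y0 s ω = Z (N s) s ω := by simp only [Y0, if_pos hω]
        rw [hY0s]
        set U := Tn (N s) ∩ Tn n with hU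
        have hUo : IsOpen U := (hTn_open _).inter (hTn_open _)
        have hsU : s ∈ U := ⟨hN s, hs⟩
        have hc : ContinuousOn (fun t => edist (Z (N s) t ω) (Z n t ω)) U :=
          continuous_edist.comp_continuousOn
            (((hcont _).mono inter_subset_left).prodMk ((hcont _).mono inter_subset_right))
        have hcl : s ∈ closure (U ∩ D) := hDd.open_subset_closure_inter hUo hsU
        have h1 := (hc s hsU).mono (inter_subset_left (t := D))
        have h2 : edist (Z (N s) s ω) (Z n s ω) ∈ closure ({0} : Set ℝ≥0∞) := h1.mem_closure hcl (fun x hx => by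
          have e1 := hω.2 _ x hx.2 hx.1.1
          have e2 := hω.2 _ x hx.2 hx.1.2
          have := edist_triangle_right (Z (N s) x ω) (Z n x ω) (X x ω)
          rw [e1, e2, add_zero] at this
          exact mem_singleton_iff.2 (le_antisymm this zero_le))
        simpa using h2
      obtain ⟨C, hC⟩ := hω.1 (N t) γ hγ hm
      refine ⟨Tn (N t), (hTn_open _).mem_nhds (hN t), C, fun s hs s' hs' => (hYY s s').trans ?_⟩
      refine le_trans ?_ (hC s hs s' hs')
      calc edist (Y0 s ω) (Y0 s' ω) ≤ edist (Y0 s ω) (Z (N t) s ω)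
            + edist (Z (N t) s ω) (Z (N t) s' ω) + edist (Z (N t) s' ω) (Y0 s' ω) :=
              edist_triangle4 _ _ _ _
        _ = _ := by rw [hcons _ s hs, edist_comm _ (Y0 s' ω), hcons _ s' hs']; simp
    · refine ⟨univ, Filter.univ_mem, 0, fun s _ s' _ => (hYY s s').trans ?_⟩
      simp [Y0, if_neg hω]
end

section
/- Let J be a finite extended pseudo-metric space with bounded covering number with constant c > 0 and exponent d > 0, let E be an extended pseudo-metric space, and let (X_t)_{t∈J} be a stochastic process satisfying the Kolmogorov condition for exponents (p, q) with constant M, where p > 0 and q > d. Then for every δ > 0, E[ sup_{s,t ∈ J, d(s,t) ≤ δ} d_E(X_s, X_t)^p ] ≤ 2^{2p+4q+1} · M · c · δ^{q−d} · ( 4^d · (max{0, log₂(c · 4^d · δ^{−d})})^q + R_p ), where R_p = max{ 1/(2^{q−d} − 1), 1/(2^{(q−d)/p} − 1)^p }. -/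
open MeasureTheory ENNReal NNReal Set

lemma aux_pow_add {p : ℝ} (hp : 0 < p) {a b A : ℝ≥0∞} (ha : a ^ p ≤ A) (hb : b ^ p ≤ A) :
    (a + b) ^ p ≤ 2 ^ p * A := by
  rcases le_total a b with h | h
  · calc (a + b) ^ p ≤ (2 * b) ^ p := by
          apply ENNReal.rpow_le_rpow _ hp.le
          rw [two_mul]; gcongr
      _ = 2 ^ p * b ^ p := ENNReal.mul_rpow_of_nonneg _ _ hp.le
      _ ≤ _ := by gcongr
  · calc (a + b) ^ p ≤ (2 * a) ^ p := by
          apply ENNReal.rpow_le_rpow _ hp.le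
          rw [two_mul]; gcongr
      _ = 2 ^ p * a ^ p := ENNReal.mul_rpow_of_nonneg _ _ hp.le
      _ ≤ _ := by gcongr

/-- Pair reduction. -/
lemma aux_pair {J : Type*} [PseudoEMetricSpace J] (η : ℝ≥0∞) (n : ℕ) (hn : 1 ≤ n) (m : ℕ) :
    ∀ V : Finset J, V.card ≤ m → V.card ≤ 2 ^ n →
    ∃ K : Finset (J × J), K.card ≤ 2 * V.card ∧ (∀ x ∈ K, edist x.1 x.2 ≤ n * η) ∧
      ∀ s ∈ V, ∀ t ∈ V, edist s t ≤ η → ∃ u, (u, s) ∈ K ∧ (u, t) ∈ K := by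
  classical
  induction m with
  | zero =>
    intro V hV _
    have : V = ∅ := by simpa using hV
    subst this
    exact ⟨∅, by simp, by simp, by simp⟩
  | succ m ih =>
    intro V hV hVn
    rcases V.eq_empty_or_nonempty with rfl | ⟨t0, ht0⟩
    · exact ⟨∅, by simp, by simp, by simp⟩
    let B : ℕ → Finset J := fun k => V.filter (fun x => edist t0 x ≤ k * η)
    have hex : ∃ k, 1 ≤ k ∧ (B k).card ≤ 2 ^ k :=
      ⟨n, hn, (Finset.card_filter_le _ _).trans hVn⟩
    let r := Nat.find hex
    obtain ⟨hr1, hr2⟩ : 1 ≤ r ∧ (B r).card ≤ 2 ^ r := Nat.find_spec hex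
    have hrn : r ≤ n := Nat.find_min' hex ⟨hn, (Finset.card_filter_le _ _).trans hVn⟩
    have htB : t0 ∈ B (r - 1) := by simp [B, ht0]
    have hlow : 2 ^ (r - 1) ≤ (B (r - 1)).card := by
      rcases Nat.eq_or_lt_of_le hr1 with h | h
      · rw [← h]; simpa using Finset.card_pos.mpr ⟨t0, by rw [← h] at htB; exact htB⟩
      · have := Nat.find_min hex (m := r - 1) (by change r - 1 < r; omega)
        by_contra hcon
        exact this ⟨by omega, by omega⟩
    have hBB : (B r).card ≤ 2 * (B (r - 1)).card := by
      calc (B r).card ≤ 2 ^ r := hr2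
        _ = 2 * 2 ^ (r - 1) := by rw [← pow_succ']; congr 1; omega
        _ ≤ _ := by gcongr
    have hsub : B (r - 1) ⊆ V := Finset.filter_subset _ _
    have hcard : (V \ B (r - 1)).card + (B (r - 1)).card = V.card :=
      Finset.card_sdiff_add_card_eq_card hsub
    have hpos : 0 < (B (r - 1)).card := Finset.card_pos.mpr ⟨t0, htB⟩
    obtain ⟨K, hK1, hK2, hK3⟩ := ih (V \ B (r - 1)) (by omega) (by omega)
    have key : ∀ s ∈ B (r - 1), ∀ t ∈ V, edist s t ≤ η → s ∈ B r ∧ t ∈ B r := by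
      intro s hs t ht hst
      simp only [B, Finset.mem_filter] at hs ⊢
      have hc : ((r : ℕ) : ℝ≥0∞) * η = ((r - 1 : ℕ) : ℝ≥0∞) * η + η := by
        conv_lhs => rw [show r = (r - 1) + 1 by omega]
        push_cast
        ring
      refine ⟨⟨hs.1, hs.2.trans ?_⟩, ht, ?_⟩
      · rw [hc]; exact le_self_add
      · rw [hc]; exact (edist_triangle t0 s t).trans (add_le_add hs.2 hst)
    refine ⟨K ∪ (B r).image (fun x => (t0, x)), ?_, ?_, ?_⟩
    · have h1 := Finset.card_union_le K ((B r).image (fun x => (t0, x)))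
      have h2 : ((B r).image (fun x => (t0, x))).card ≤ (B r).card := Finset.card_image_le
      omega
    · intro x hx
      rcases Finset.mem_union.mp hx with hx | hx
      · exact hK2 x hx
      · obtain ⟨y, hy, rfl⟩ := Finset.mem_image.mp hx
        have := (Finset.mem_filter.mp hy).2
        exact this.trans (by gcongr)
    · intro s hs t ht hst
      by_cases hsB : s ∈ B (r - 1)
      · obtain ⟨h1, h2⟩ := key s hsB t ht hst
        exact ⟨t0, Finset.mem_union_right _ (Finset.mem_image_of_mem _ h1),
          Finset.mem_union_right _ (Finset.mem_image_of_mem _ h2)⟩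
      · by_cases htB' : t ∈ B (r - 1)
        · obtain ⟨h1, h2⟩ := key t htB' s hs (by rwa [edist_comm])
          exact ⟨t0, Finset.mem_union_right _ (Finset.mem_image_of_mem _ h2),
            Finset.mem_union_right _ (Finset.mem_image_of_mem _ h1)⟩
        · obtain ⟨u, h1, h2⟩ := hK3 s (by simp [hs, hsB]) t (by simp [ht, htB']) hst
          exact ⟨u, Finset.mem_union_left _ h1, Finset.mem_union_left _ h2⟩

lemma aux_meas {T Ω E : Type*} [PseudoEMetricSpace T] [PseudoEMetricSpace E]
    [MeasurableSpace Ω] {X : T → Ω → E} {P : Measure Ω} {p q : ℝ} {M : ℝ≥0}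
    (hX : IsKolmogorovProcess X P p q M) (s t : T) :
    Measurable fun ω => edist (X s ω) (X t ω) := by
  let _ : MeasurableSpace (E × E) := borel (E × E)
  have : BorelSpace (E × E) := ⟨rfl⟩
  exact (continuous_edist (α := E)).measurable.comp (hX.1 s t)

lemma aux_pairG {J Ω E : Type*} [PseudoEMetricSpace J]
    [MeasurableSpace Ω] [PseudoEMetricSpace E]
    {P : Measure Ω} {X : J → Ω → E} {M : ℝ≥0} {p q : ℝ} (hp : 0 < p) (hq : 0 < q)
    (hX : IsKolmogorovProcess X P p q M) (C : Finset J) (hC : C.Nonempty) {η : ℝ} (hη : 0 ≤ η) :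
    ∃ G : Ω → ℝ≥0∞, Measurable G ∧
      (∀ ω, ∀ s ∈ C, ∀ t ∈ C, edist s t ≤ ENNReal.ofReal η → edist (X s ω) (X t ω) ^ p ≤ G ω) ∧
      ∫⁻ ω, G ω ∂P ≤
        ENNReal.ofReal (2 ^ (p + 1) * C.card * M * (2 * Real.logb 2 C.card * η) ^ q) := by
  classical
  rcases Nat.lt_or_ge 1 C.card with h1 | h1
  swap
  · refine ⟨0, measurable_zero, ?_, by simp⟩
    intro ω s hs t ht _
    rw [Finset.card_le_one.mp h1 s hs t ht]
    simp [hp]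
  set n := Nat.clog 2 C.card with hn
  have hn1 : 1 ≤ n := Nat.clog_pos (by norm_num) h1
  have hCn : C.card ≤ 2 ^ n := Nat.le_pow_clog (by norm_num) _
  have hlog : (n : ℝ) ≤ 2 * Real.logb 2 C.card := by
    have hlt : 2 ^ (n - 1) < C.card := by
      have := Nat.pow_pred_clog_lt_self (b := 2) (by norm_num) h1
      simpa [hn] using this
    have hcR : (1 : ℝ) < C.card := by exact_mod_cast h1
    have e1 : ((n - 1 : ℕ) : ℝ) ≤ Real.logb 2 C.card := by
      rw [Real.le_logb_iff_rpow_le (by norm_num) (by linarith), Real.rpow_natCast]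
      exact_mod_cast hlt.le
    have e2 : (1 : ℝ) ≤ Real.logb 2 C.card := by
      rw [Real.le_logb_iff_rpow_le (by norm_num) (by linarith), Real.rpow_one]
      exact_mod_cast h1
    push_cast [hn1] at e1
    linarith
  obtain ⟨K, hK1, hK2, hK3⟩ := aux_pair (ENNReal.ofReal η) n hn1 C.card C le_rfl hCn
  refine ⟨fun ω => 2 ^ p * ∑ x ∈ K, edist (X x.1 ω) (X x.2 ω) ^ p, ?_, ?_, ?_⟩
  · exact (Finset.measurable_sum _ fun x _ => (aux_meas hX _ _).pow_const p).const_mul _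
  · intro ω s hs t ht hst
    obtain ⟨u, h1, h2⟩ := hK3 s hs t ht hst
    calc edist (X s ω) (X t ω) ^ p ≤ (edist (X u ω) (X s ω) + edist (X u ω) (X t ω)) ^ p := by
          gcongr
          exact edist_triangle_left _ _ _
      _ ≤ _ := aux_pow_add hp
          (Finset.single_le_sum (f := fun x : J × J => edist (X x.1 ω) (X x.2 ω) ^ p)
            (fun _ _ => zero_le) h1)
          (Finset.single_le_sum (f := fun x : J × J => edist (X x.1 ω) (X x.2 ω) ^ p)
            (fun _ _ => zero_le) h2)
  · rw [lintegral_const_mul _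
      (Finset.measurable_sum _ fun x _ => (aux_meas hX _ _).pow_const p),
      lintegral_finsetSum _ fun x _ => (aux_meas hX _ _).pow_const p]
    have hn0 : (0 : ℝ) ≤ n * η := by positivity
    have step : ∑ x ∈ K, ∫⁻ ω, edist (X x.1 ω) (X x.2 ω) ^ p ∂P
        ≤ ENNReal.ofReal (2 * C.card * (M * (n * η) ^ q)) := by
      calc ∑ x ∈ K, ∫⁻ ω, edist (X x.1 ω) (X x.2 ω) ^ p ∂P
          ≤ ∑ x ∈ K, ENNReal.ofReal (M * (n * η) ^ q) := by
            refine Finset.sum_le_sum fun x hx => (hX.2 _ _).trans ?_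
            rw [ENNReal.ofReal_mul (by positivity), ← ENNReal.ofReal_rpow_of_nonneg hn0 hq.le,
              ENNReal.ofReal_coe_nnreal, ENNReal.ofReal_mul (by positivity),
              ENNReal.ofReal_natCast]
            gcongr
            exact hK2 x hx
        _ = ENNReal.ofReal (K.card * (M * (n * η) ^ q)) := by
            rw [Finset.sum_const, nsmul_eq_mul,
              ENNReal.ofReal_mul (by positivity : (0 : ℝ) ≤ K.card), ENNReal.ofReal_natCast]
        _ ≤ _ := by
            apply ENNReal.ofReal_le_ofReal
            have : (K.card : ℝ) ≤ 2 * C.card := by exact_mod_cast hK1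
            gcongr
    calc _ ≤ (2 : ℝ≥0∞) ^ p * ENNReal.ofReal (2 * C.card * (M * (n * η) ^ q)) := by gcongr
      _ = ENNReal.ofReal (2 ^ p * (2 * C.card * (M * (n * η) ^ q))) := by
          rw [ENNReal.ofReal_mul (by positivity : (0 : ℝ) ≤ 2 ^ p),
            ← ENNReal.ofReal_rpow_of_pos (by norm_num)]
          simp
      _ ≤ _ := by
          apply ENNReal.ofReal_le_ofReal
          rw [Real.rpow_add (by norm_num), Real.rpow_one]
          have : ((n : ℝ) * η) ^ q ≤ (2 * Real.logb 2 C.card * η) ^ q := by gcongr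
          calc _ = 2 ^ p * 2 * C.card * M * ((n : ℝ) * η) ^ q := by ring
            _ ≤ _ := by gcongr

lemma aux_sum_le_one {Ω : Type*} [MeasurableSpace Ω] {P : Measure Ω} {p : ℝ} (hp : 0 < p)
    (hp1 : p ≤ 1) (D : ℕ → Ω → ℝ≥0∞) (hD : ∀ k, Measurable (D k)) (N : ℕ) :
    ∫⁻ ω, (∑ k ∈ Finset.range N, D k ω) ^ p ∂P ≤
      ∑ k ∈ Finset.range N, ∫⁻ ω, D k ω ^ p ∂P := by
  induction N with
  | zero => simp [hp]
  | succ N ih =>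
    simp only [Finset.sum_range_succ]
    calc _ ≤ ∫⁻ ω, ((∑ k ∈ Finset.range N, D k ω) ^ p + D N ω ^ p) ∂P :=
          lintegral_mono fun ω => ENNReal.rpow_add_le_add_rpow _ _ hp.le hp1
      _ = _ := lintegral_add_right _ ((hD N).pow_const p)
      _ ≤ _ := by gcongr

lemma aux_sum_ge_one {Ω : Type*} [MeasurableSpace Ω] {P : Measure Ω} {p : ℝ}
    (hp1 : 1 ≤ p) (D : ℕ → Ω → ℝ≥0∞) (hD : ∀ k, Measurable (D k)) (N : ℕ) :
    (∫⁻ ω, (∑ k ∈ Finset.range N, D k ω) ^ p ∂P) ^ (1 / p) ≤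
      ∑ k ∈ Finset.range N, (∫⁻ ω, D k ω ^ p ∂P) ^ (1 / p) := by
  have hp : 0 < p := by linarith
  induction N with
  | zero => simp [hp]
  | succ N ih =>
    simp only [Finset.sum_range_succ]
    have := ENNReal.lintegral_Lp_add_le (μ := P) (p := p)
      (f := fun ω => ∑ k ∈ Finset.range N, D k ω) (g := D N)
      (Finset.measurable_sum _ fun k _ => hD k).aemeasurable (hD N).aemeasurable hp1
    exact this.trans (by gcongr)

lemma aux_geom {ρ : ℝ} (h0 : 0 ≤ ρ) (h1 : ρ < 1) (N : ℕ) :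
    ∑ k ∈ Finset.range N, ρ ^ k ≤ 1 / (1 - ρ) := by
  rw [one_div, ← tsum_geometric_of_lt_one h0 h1]
  exact (summable_geometric_of_lt_one h0 h1).sum_le_tsum _ (fun _ _ => by positivity)

lemma aux_sum {Ω : Type*} [MeasurableSpace Ω] {P : Measure Ω} {p : ℝ} (hp : 0 < p)
    (D : ℕ → Ω → ℝ≥0∞) (hD : ∀ k, Measurable (D k)) (N : ℕ) {A ρ : ℝ} (hA : 0 ≤ A)
    (h0 : 0 < ρ) (h1 : ρ < 1) (hDk : ∀ k, ∫⁻ ω, D k ω ^ p ∂P ≤ ENNReal.ofReal (A * ρ ^ k)) :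
    ∫⁻ ω, (∑ k ∈ Finset.range N, D k ω) ^ p ∂P ≤
      ENNReal.ofReal (A * max (1 / (1 - ρ)) (1 / (1 - ρ ^ (1 / p)) ^ p)) := by
  rcases le_total p 1 with hp1 | hp1
  · refine (aux_sum_le_one hp hp1 D hD N).trans ((Finset.sum_le_sum fun k _ => hDk k).trans ?_)
    rw [← ENNReal.ofReal_sum_of_nonneg (fun _ _ => by positivity), ← Finset.mul_sum]
    apply ENNReal.ofReal_le_ofReal
    gcongr
    exact (aux_geom h0.le h1 N).trans (le_max_left _ _)
  · have key : (∫⁻ ω, (∑ k ∈ Finset.range N, D k ω) ^ p ∂P) ^ (1 / p) ≤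
        ENNReal.ofReal (A ^ (1 / p) * (1 / (1 - ρ ^ (1 / p)))) := by
      refine (aux_sum_ge_one hp1 D hD N).trans ?_
      calc _ ≤ ∑ k ∈ Finset.range N, ENNReal.ofReal (A ^ (1 / p) * (ρ ^ (1 / p)) ^ k) := by
            refine Finset.sum_le_sum fun k _ => ?_
            refine (ENNReal.rpow_le_rpow (hDk k) (by positivity)).trans ?_
            rw [ENNReal.ofReal_rpow_of_nonneg (by positivity) (by positivity),
              Real.mul_rpow hA (by positivity), ← Real.rpow_natCast, ← Real.rpow_natCast,
              ← Real.rpow_mul h0.le, ← Real.rpow_mul h0.le, mul_comm (k : ℝ)]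
        _ = ENNReal.ofReal (A ^ (1 / p) * ∑ k ∈ Finset.range N, (ρ ^ (1 / p)) ^ k) := by
            rw [← ENNReal.ofReal_sum_of_nonneg (fun _ _ => by positivity), ← Finset.mul_sum]
        _ ≤ _ := by
            apply ENNReal.ofReal_le_ofReal
            gcongr
            exact aux_geom (by positivity) (Real.rpow_lt_one h0.le h1 (by positivity)) N
    have hlt : ρ ^ (1 / p) < 1 := Real.rpow_lt_one h0.le h1 (by positivity)
    have hsub : 0 < 1 - ρ ^ (1 / p) := by linarith
    have := ENNReal.rpow_le_rpow key hp.le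
    rw [← ENNReal.rpow_mul, one_div_mul_cancel hp.ne', ENNReal.rpow_one,
      ENNReal.ofReal_rpow_of_nonneg (by positivity) hp.le, Real.mul_rpow (by positivity)
      (by positivity), ← Real.rpow_mul hA, one_div_mul_cancel hp.ne', Real.rpow_one,
      Real.div_rpow (by norm_num) hsub.le, Real.one_rpow] at this
    refine this.trans (ENNReal.ofReal_le_ofReal ?_)
    gcongr
    exact le_max_right _ _

lemma aux_ae_zero {J Ω E : Type*} [PseudoEMetricSpace J] [Fintype J]
    [MeasurableSpace Ω] [PseudoEMetricSpace E]
    {P : Measure Ω} {X : J → Ω → E} {M : ℝ≥0} {p q : ℝ} (hp : 0 < p) (hq : 0 < q)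
    (hX : IsKolmogorovProcess X P p q M) :
    ∀ᵐ ω ∂P, ∀ s t : J, edist s t = 0 → edist (X s ω) (X t ω) = 0 := by
  rw [ae_all_iff]; intro s
  rw [ae_all_iff]; intro t
  by_cases hst : edist s t = 0
  · have h := hX.2 s t
    rw [hst, ENNReal.zero_rpow_of_pos hq, mul_zero, nonpos_iff_eq_zero,
      lintegral_eq_zero_iff ((aux_meas hX s t).pow_const p)] at h
    filter_upwards [h] with ω hω _
    simpa [hp, hp.not_gt] using hω
  · exact Filter.Eventually.of_forall fun ω h => absurd h hst

lemma aux_chain {J Ω E : Type*} [PseudoEMetricSpace J] [Fintype J]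
    [MeasurableSpace Ω] [PseudoEMetricSpace E]
    {P : Measure Ω} {X : J → Ω → E} {c M : ℝ≥0} {d p q : ℝ}
    (hd : 0 < d) (hp : 0 < p) (hq : d < q)
    (hJ : HasBoundedInternalCoveringNumber (Set.univ : Set J) c d)
    (hX : IsKolmogorovProcess X P p q M) {ε : ℝ} (hε : 0 < ε)
    (hεD : ENNReal.ofReal ε ≤ EMetric.diam (Set.univ : Set J))
    (C0 : Finset J) (hC0 : ∀ t : J, ∃ s ∈ C0, edist t s ≤ ENNReal.ofReal ε) :
    ∃ (π : J → J) (H : Ω → ℝ≥0∞), Measurable H ∧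
      (∀ s, π s ∈ C0 ∧ edist s (π s) ≤ ENNReal.ofReal (2 * ε)) ∧
      (∀ᵐ ω ∂P, ∀ s, edist (X s ω) (X (π s) ω) ^ p ≤ H ω) ∧
      ∫⁻ ω, H ω ∂P ≤ ENNReal.ofReal (M * c * 2 ^ q * ε ^ (q - d) *
        max (1 / (2 ^ (q - d) - 1)) (1 / ((2 : ℝ) ^ ((q - d) / p) - 1) ^ p)) := by
  classical
  have hq0 : 0 < q := hd.trans hq
  let e : ℕ → ℝ := fun k => ε * (1 / 2) ^ k
  have he : ∀ k, 0 < e k := fun k => by positivity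
  have heε : ∀ k, e k ≤ ε := fun k =>
    mul_le_of_le_one_right hε.le (pow_le_one₀ (by norm_num) (by norm_num))
  choose S _ hS2 hS3 using fun k => hJ (ENNReal.ofReal (e k)) (by simpa using he k)
    ((ENNReal.ofReal_le_ofReal (heε k)).trans hεD)
  let Cn : ℕ → Finset J := fun k => match k with
    | 0 => C0
    | k + 1 => S (k + 1)
  have hcov : ∀ k t, ∃ s ∈ Cn k, edist t s ≤ ENNReal.ofReal (e k) := by
    intro k t
    cases k with
    | zero => simpa [Cn, e] using hC0 t
    | succ k => exact hS2 (k + 1) t (mem_univ t)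
  choose pr hpr1 hpr2 using hcov
  let D : ℕ → Ω → ℝ≥0∞ := fun k ω =>
    (∑ u ∈ Cn (k + 1), edist (X u ω) (X (pr k u) ω) ^ p) ^ (1 / p)
  have hDm : ∀ k, Measurable (D k) := fun k =>
    (Finset.measurable_sum _ fun u _ => (aux_meas hX _ _).pow_const p).pow_const _
  have hDp : ∀ k ω, D k ω ^ p = ∑ u ∈ Cn (k + 1), edist (X u ω) (X (pr k u) ω) ^ p := by
    intro k ω
    simp only [D]
    rw [← ENNReal.rpow_mul, one_div_mul_cancel hp.ne', ENNReal.rpow_one]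
  have hDle : ∀ k ω, ∀ u ∈ Cn (k + 1), edist (X u ω) (X (pr k u) ω) ≤ D k ω := by
    intro k ω u hu
    rw [← ENNReal.rpow_le_rpow_iff hp, hDp]
    exact Finset.single_le_sum (f := fun u => edist (X u ω) (X (pr k u) ω) ^ p)
      (fun _ _ => zero_le) hu
  have hchain : ∀ N, ∃ π : J → J, ∀ s ∈ Cn N, π s ∈ C0 ∧
      edist s (π s) ≤ ∑ k ∈ Finset.range N, ENNReal.ofReal (e k) ∧
      ∀ ω, edist (X s ω) (X (π s) ω) ≤ ∑ k ∈ Finset.range N, D k ω := by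
    intro N
    induction N with
    | zero => exact ⟨id, fun s hs => ⟨hs, by simp, by simp⟩⟩
    | succ N ih =>
      obtain ⟨π, hπ⟩ := ih
      refine ⟨fun s => π (pr N s), fun s hs => ?_⟩
      obtain ⟨h1, h2, h3⟩ := hπ (pr N s) (hpr1 N s)
      refine ⟨h1, ?_, fun ω => ?_⟩
      · rw [Finset.sum_range_succ, add_comm]
        exact (edist_triangle _ (pr N s) _).trans (add_le_add (hpr2 N s) h2)
      · rw [Finset.sum_range_succ, add_comm]
        exact (edist_triangle _ (X (pr N s) ω) _).trans (add_le_add (hDle N ω s hs) (h3 ω))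
  obtain ⟨N, hN⟩ : ∃ N, ∀ s t : J, edist s t ≤ ENNReal.ofReal (e N) → edist s t = 0 := by
    have hlim : Filter.Tendsto (fun k => ENNReal.ofReal (e k)) Filter.atTop (nhds 0) := by
      have : Filter.Tendsto e Filter.atTop (nhds 0) := by
        simpa [e] using (tendsto_pow_atTop_nhds_zero_of_lt_one (r := (1 / 2 : ℝ)) (by norm_num)
          (by norm_num)).const_mul ε
      simpa using ENNReal.tendsto_ofReal this
    have : ∀ᶠ k in Filter.atTop, ∀ s t : J, edist s t ≤ ENNReal.ofReal (e k) → edist s t = 0 := by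
      rw [Filter.eventually_all]; intro s
      rw [Filter.eventually_all]; intro t
      by_cases hst : edist s t = 0
      · exact Filter.Eventually.of_forall fun _ _ => hst
      · filter_upwards [hlim.eventually_lt_const (pos_iff_ne_zero.mpr hst)] with k hk h
        exact absurd hk h.not_gt
    exact this.exists
  obtain ⟨π, hπ⟩ := hchain N
  have hpr0 : ∀ s, edist s (pr N s) = 0 := fun s => hN _ _ (hpr2 N s)
  refine ⟨fun s => π (pr N s), fun ω => (∑ k ∈ Finset.range N, D k ω) ^ p,
    (Finset.measurable_sum _ fun k _ => hDm k).pow_const p, fun s => ⟨(hπ _ (hpr1 N s)).1, ?_⟩,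
    ?_, ?_⟩
  · refine (edist_triangle s (pr N s) _).trans ?_
    rw [hpr0, zero_add]
    refine (hπ _ (hpr1 N s)).2.1.trans ?_
    rw [← ENNReal.ofReal_sum_of_nonneg (fun k _ => (he k).le)]
    apply ENNReal.ofReal_le_ofReal
    simp only [e]
    rw [← Finset.mul_sum, mul_comm 2]
    gcongr
    refine (aux_geom (by norm_num) (by norm_num) N).trans (by norm_num)
  · filter_upwards [aux_ae_zero hp hq0 hX] with ω hω s
    gcongr
    refine (edist_triangle _ (X (pr N s) ω) _).trans ?_
    rw [hω _ _ (hpr0 s), zero_add]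
    exact (hπ _ (hpr1 N s)).2.2 ω
  · have hqd : 0 < q - d := by linarith
    have hρ1 : (2 : ℝ) ^ (-(q - d)) < 1 := Real.rpow_lt_one_of_one_lt_of_neg (by norm_num)
      (by linarith)
    refine (aux_sum hp D hDm N (A := M * c * 2 ^ d * ε ^ (q - d)) (ρ := 2 ^ (-(q - d)))
      (by positivity) (by positivity) hρ1 ?_).trans (le_of_eq ?_)
    · intro k
      simp only [hDp]
      rw [lintegral_finsetSum _ fun x _ => (aux_meas hX _ _).pow_const p]
      have hcard : ((Cn (k + 1)).card : ℝ≥0∞) ≤ ENNReal.ofReal (c * (e (k + 1)) ^ (-d)) := by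
        refine (hS3 (k + 1)).trans (le_of_eq ?_)
        rw [ENNReal.ofReal_mul (by positivity : (0 : ℝ) ≤ c), ENNReal.ofReal_rpow_of_pos (he _),
          ENNReal.ofReal_coe_nnreal]
      calc _ ≤ ∑ u ∈ Cn (k + 1), ENNReal.ofReal (M * e k ^ q) := by
            refine Finset.sum_le_sum fun u _ => (hX.2 _ _).trans ?_
            rw [ENNReal.ofReal_mul (by positivity),
              ← ENNReal.ofReal_rpow_of_nonneg (he k).le hq0.le, ENNReal.ofReal_coe_nnreal]
            gcongr
            exact hpr2 k u
        _ = (Cn (k + 1)).card * ENNReal.ofReal (M * e k ^ q) := by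
            rw [Finset.sum_const, nsmul_eq_mul]
        _ ≤ ENNReal.ofReal (c * (e (k + 1)) ^ (-d)) * ENNReal.ofReal (M * e k ^ q) := by gcongr
        _ = ENNReal.ofReal (c * (e (k + 1)) ^ (-d) * (M * e k ^ q)) := by
            rw [ENNReal.ofReal_mul
              (by have := he (k + 1); positivity : (0 : ℝ) ≤ c * (e (k + 1)) ^ (-d))]
        _ = _ := by
            congr 1
            have h1 : e (k + 1) = e k * 2⁻¹ := by simp only [e]; rw [pow_succ]; ring
            have h2 : (e k * 2⁻¹) ^ (-d) = e k ^ (-d) * 2 ^ d := by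
              rw [Real.mul_rpow (he k).le (by norm_num), Real.inv_rpow (by norm_num),
                Real.rpow_neg (by norm_num : (0 : ℝ) ≤ 2), inv_inv]
            have h3 : e k ^ (-d) * e k ^ q = ε ^ (q - d) * ((2 : ℝ) ^ (-(q - d))) ^ k := by
              rw [← Real.rpow_add (he k), show -d + q = q - d by ring]
              simp only [e]
              rw [Real.mul_rpow hε.le (by positivity), ← Real.rpow_natCast, ← Real.rpow_natCast,
                ← Real.rpow_mul (by norm_num), ← Real.rpow_mul (by norm_num), one_div,
                Real.inv_rpow (by norm_num), ← Real.rpow_neg (by norm_num)]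
              congr 2; ring
            rw [h1, h2]
            linear_combination (c * 2 ^ d * M : ℝ) * h3
    · congr 1
      have h2q : (2 : ℝ) ^ q = 2 ^ d * 2 ^ (q - d) := by
        rw [← Real.rpow_add (by norm_num)]; congr 1; ring
      have hone : (1 : ℝ) < 2 ^ (q - d) := Real.one_lt_rpow (by norm_num) hqd
      have hone' : (1 : ℝ) < 2 ^ ((q - d) / p) := Real.one_lt_rpow (by norm_num) (by positivity)
      have a1 : 1 / (1 - (2 : ℝ) ^ (-(q - d))) = 2 ^ (q - d) * (1 / (2 ^ (q - d) - 1)) := by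
        have : (2 : ℝ) ^ (q - d) - 1 ≠ 0 := by linarith
        rw [Real.rpow_neg (by norm_num)]
        have h' : 1 - ((2 : ℝ) ^ (q - d))⁻¹ ≠ 0 := by
          have : ((2 : ℝ) ^ (q - d))⁻¹ < 1 := inv_lt_one_of_one_lt₀ hone
          linarith
        field_simp
      have a2 : 1 / (1 - ((2 : ℝ) ^ (-(q - d))) ^ (1 / p)) ^ p =
          2 ^ (q - d) * (1 / (2 ^ ((q - d) / p) - 1) ^ p) := by
        have b1 : 1 - ((2 : ℝ) ^ (-(q - d))) ^ (1 / p) =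
            (2 ^ ((q - d) / p) - 1) / 2 ^ ((q - d) / p) := by
          rw [← Real.rpow_mul (by norm_num), show -(q - d) * (1 / p) = -((q - d) / p) by ring,
            Real.rpow_neg (by norm_num)]
          field_simp
        rw [b1, Real.div_rpow (by linarith) (by positivity), ← Real.rpow_mul (by norm_num),
          div_mul_cancel₀ _ hp.ne', one_div_div]
        ring
      rw [a1, a2, ← mul_max_of_nonneg _ _ (by positivity), h2q]
      ring

lemma aux_combine {J Ω E : Type*} [PseudoEMetricSpace J] [Fintype J]
    [MeasurableSpace Ω] [PseudoEMetricSpace E]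
    {P : Measure Ω} {X : J → Ω → E} {c M : ℝ≥0} {d p q : ℝ}
    (hd : 0 < d) (hp : 0 < p) (hq : d < q)
    (hJ : HasBoundedInternalCoveringNumber (Set.univ : Set J) c d)
    (hX : IsKolmogorovProcess X P p q M) {ε : ℝ} (hε : 0 < ε)
    (hεD : ENNReal.ofReal ε ≤ EMetric.diam (Set.univ : Set J))
    (C0 : Finset J) (hC0 : ∀ t : J, ∃ s ∈ C0, edist t s ≤ ENNReal.ofReal ε)
    {δ : ℝ} (hδ : 0 < δ) (hεδ : ε ≤ δ / 4) {L : ℝ} (hL : 0 ≤ L)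
    (G : Ω → ℝ≥0∞) (hG : Measurable G)
    (hG1 : ∀ ω, ∀ s ∈ C0, ∀ t ∈ C0, edist s t ≤ ENNReal.ofReal (2 * δ) →
      edist (X s ω) (X t ω) ^ p ≤ G ω)
    (hG2 : ∫⁻ ω, G ω ∂P ≤
      ENNReal.ofReal (2 ^ (p + 2 * q + 1) * M * c * δ ^ (q - d) * (4 ^ d * L ^ q))) :
    ∫⁻ ω, ⨆ (s : J) (t : J) (_ : edist s t ≤ ENNReal.ofReal δ), edist (X s ω) (X t ω) ^ p ∂P
      ≤ ENNReal.ofReal ((2 : ℝ) ^ (2 * p + 4 * q + 1) * M * c * δ ^ (q - d) *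
          ((4 : ℝ) ^ d * L ^ q +
            max (1 / (2 ^ (q - d) - 1)) (1 / ((2 : ℝ) ^ ((q - d) / p) - 1) ^ p))) := by
  obtain ⟨π, H, hH, hπ, hH1, hH2⟩ := aux_chain hd hp hq hJ hX hε hεD C0 hC0
  have hqd : 0 < q - d := by linarith
  have hone : (1 : ℝ) < 2 ^ (q - d) := Real.one_lt_rpow (by norm_num) hqd
  set R := max (1 / (2 ^ (q - d) - 1)) (1 / ((2 : ℝ) ^ ((q - d) / p) - 1) ^ p) with hR
  have hR0 : 0 ≤ R := le_max_of_le_left (one_div_nonneg.mpr (by linarith))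
  have h2p : (2 : ℝ≥0∞) ^ p = ENNReal.ofReal (2 ^ p) := by
    rw [← ENNReal.ofReal_rpow_of_pos (by norm_num)]; simp
  calc _ ≤ ∫⁻ ω, 2 ^ p * (2 ^ p * H ω + G ω) ∂P := by
        apply lintegral_mono_ae
        filter_upwards [hH1] with ω hω
        refine iSup_le fun s => iSup_le fun t => iSup_le fun hst => ?_
        have hd' : edist (π s) (π t) ≤ ENNReal.ofReal (2 * δ) := by
          calc edist (π s) (π t) ≤ edist (π s) s + edist s t + edist t (π t) :=
                edist_triangle4 _ _ _ _
            _ ≤ ENNReal.ofReal (2 * ε) + ENNReal.ofReal δ + ENNReal.ofReal (2 * ε) := by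
                gcongr
                · rw [edist_comm]; exact (hπ s).2
                · exact (hπ t).2
            _ = ENNReal.ofReal (2 * ε + δ + 2 * ε) := by
                rw [← ENNReal.ofReal_add (by positivity) (by positivity),
                  ← ENNReal.ofReal_add (by positivity) (by positivity)]
            _ ≤ _ := ENNReal.ofReal_le_ofReal (by linarith)
        calc edist (X s ω) (X t ω) ^ p
            ≤ ((edist (X s ω) (X (π s) ω) + edist (X t ω) (X (π t) ω)) +
                edist (X (π s) ω) (X (π t) ω)) ^ p := by
              gcongr
              refine (edist_triangle4 _ (X (π s) ω) (X (π t) ω) _).trans (le_of_eq ?_)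
              rw [edist_comm (X (π t) ω)]
              ring
          _ ≤ _ := by
              apply aux_pow_add hp
              · exact (aux_pow_add hp (hω s) (hω t)).trans le_self_add
              · exact (hG1 ω _ (hπ s).1 _ (hπ t).1 hd').trans le_add_self
    _ = 2 ^ p * (2 ^ p * ∫⁻ ω, H ω ∂P + ∫⁻ ω, G ω ∂P) := by
        rw [lintegral_const_mul _ (by fun_prop), lintegral_add_right _ hG,
          lintegral_const_mul _ hH]
    _ ≤ 2 ^ p * (2 ^ p * ENNReal.ofReal (M * c * 2 ^ q * ε ^ (q - d) * R) +
          ENNReal.ofReal (2 ^ (p + 2 * q + 1) * M * c * δ ^ (q - d) * (4 ^ d * L ^ q))) := by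
        gcongr
    _ = ENNReal.ofReal (2 ^ p * (2 ^ p * (M * c * 2 ^ q * ε ^ (q - d) * R) +
          2 ^ (p + 2 * q + 1) * M * c * δ ^ (q - d) * (4 ^ d * L ^ q))) := by
        rw [h2p, ← ENNReal.ofReal_mul (by positivity),
          ← ENNReal.ofReal_add (by positivity) (by positivity),
          ← ENNReal.ofReal_mul (by positivity)]
    _ ≤ _ := by
        apply ENNReal.ofReal_le_ofReal
        have e1 : ε ^ (q - d) ≤ δ ^ (q - d) :=
          Real.rpow_le_rpow hε.le (by linarith) hqd.le
        have e2 : (2 : ℝ) ^ p * 2 ^ p * 2 ^ q ≤ 2 ^ (2 * p + 4 * q + 1) := by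
          rw [← Real.rpow_add (by norm_num), ← Real.rpow_add (by norm_num)]
          exact Real.rpow_le_rpow_of_exponent_le (by norm_num) (by linarith)
        have e3 : (2 : ℝ) ^ p * 2 ^ (p + 2 * q + 1) ≤ 2 ^ (2 * p + 4 * q + 1) := by
          rw [← Real.rpow_add (by norm_num)]
          exact Real.rpow_le_rpow_of_exponent_le (by norm_num) (by linarith)
        calc _ = (2 ^ p * 2 ^ p * 2 ^ q) * M * c * ε ^ (q - d) * R +
              (2 ^ p * 2 ^ (p + 2 * q + 1)) * M * c * δ ^ (q - d) * (4 ^ d * L ^ q) := by ring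
          _ ≤ 2 ^ (2 * p + 4 * q + 1) * M * c * δ ^ (q - d) * R +
              2 ^ (2 * p + 4 * q + 1) * M * c * δ ^ (q - d) * (4 ^ d * L ^ q) := by
              gcongr
          _ = _ := by ring

/-- Bound on the expected supremum, over pairs of close points of a finite index space, of the
`p`-th power of the increments of a process satisfying the Kolmogorov condition: for a finite
pseudo-emetric space `J` with bounded covering number with constant `c > 0` and exponent
`d ∈ (0, q)` and every `δ > 0`,
`E[⨆ (s t : J) (_ : edist s t ≤ δ), d_E(X s, X t) ^ p]
  ≤ 2 ^ (2p + 4q + 1) * M * c * δ ^ (q - d)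
      * (4 ^ d * (max 0 (log₂ (c * 4 ^ d * δ ^ (-d)))) ^ q + R_p)`,
where `R_p = max (1 / (2 ^ (q - d) - 1)) (1 / (2 ^ ((q - d) / p) - 1) ^ p)`. -/
theorem finite_set_bound_of_edist_le {J Ω E : Type*} [PseudoEMetricSpace J] [Fintype J]
    [MeasurableSpace Ω] [PseudoEMetricSpace E]
    {P : Measure Ω} [IsProbabilityMeasure P] {X : J → Ω → E}
    {c M : ℝ≥0} {d p q : ℝ}
    (hc : 0 < c) (hd : 0 < d) (hp : 0 < p) (hq : d < q)
    (hJ : HasBoundedInternalCoveringNumber (Set.univ : Set J) c d)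
    (hX : IsKolmogorovProcess X P p q M)
    {δ : ℝ} (hδ : 0 < δ) :
    ∫⁻ ω, ⨆ (s : J) (t : J) (_ : edist s t ≤ ENNReal.ofReal δ), edist (X s ω) (X t ω) ^ p ∂P
      ≤ ENNReal.ofReal ((2 : ℝ) ^ (2 * p + 4 * q + 1) * M * c * δ ^ (q - d) *
          ((4 : ℝ) ^ d * (max 0 (Real.logb 2 (c * 4 ^ d * δ ^ (-d)))) ^ q +
            max (1 / (2 ^ (q - d) - 1)) (1 / ((2 : ℝ) ^ ((q - d) / p) - 1) ^ p))) := by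
  have hq0 : 0 < q := hd.trans hq
  set D := EMetric.diam (Set.univ : Set J) with hD
  have hle : ∀ s t : J, edist s t ≤ D := fun s t =>
    EMetric.edist_le_diam_of_mem (mem_univ s) (mem_univ t)
  rcases eq_or_ne D 0 with hD0 | hD0
  · refine le_trans (le_of_eq ?_) zero_le
    rw [← lintegral_zero (μ := P)]
    apply lintegral_congr_ae
    filter_upwards [aux_ae_zero hp hq0 hX] with ω hω
    have : ∀ s t : J, edist (X s ω) (X t ω) = 0 := fun s t =>
      hω s t (by simpa [hD0] using hle s t)
    simp [this, hp]
  have hDpos : 0 < D := pos_iff_ne_zero.mpr hD0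
  obtain ⟨x0⟩ : Nonempty J := by
    by_contra hne
    rw [not_nonempty_iff] at hne
    apply hD0
    rw [hD, Set.eq_empty_of_isEmpty (Set.univ : Set J)]
    exact EMetric.diam_empty
  have hDtop : D ≠ ⊤ := by
    intro htop
    obtain ⟨S, _, h2, h3⟩ := hJ ⊤ (by simp) (by rw [← hD, htop])
    obtain ⟨s, hs, _⟩ := h2 x0 (mem_univ _)
    rw [ENNReal.top_rpow_of_neg (by linarith), mul_zero, nonpos_iff_eq_zero] at h3
    have : S.card = 0 := by exact_mod_cast h3
    rw [Finset.card_eq_zero] at this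
    simp [this] at hs
  have hDr : 0 < D.toReal := ENNReal.toReal_pos hD0 hDtop
  rcases le_or_gt (δ / 4) D.toReal with hcase | hcase
  · have hεD : ENNReal.ofReal (δ / 4) ≤ D := ENNReal.ofReal_le_of_le_toReal hcase
    obtain ⟨S, _, h2, h3⟩ := hJ (ENNReal.ofReal (δ / 4)) (by simpa using hδ) hεD
    have hSne : S.Nonempty := by
      obtain ⟨s, hs, _⟩ := h2 x0 (mem_univ _)
      exact ⟨s, hs⟩
    have hcard : (S.card : ℝ) ≤ c * 4 ^ d * δ ^ (-d) := by
      have : ENNReal.ofReal (S.card : ℝ) ≤ ENNReal.ofReal (c * (δ / 4) ^ (-d)) := by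
        rw [ENNReal.ofReal_mul (by positivity), ← ENNReal.ofReal_rpow_of_pos (by positivity),
          ENNReal.ofReal_coe_nnreal, ENNReal.ofReal_natCast]
        exact h3
      rw [ENNReal.ofReal_le_ofReal_iff (by positivity)] at this
      refine this.trans (le_of_eq ?_)
      rw [Real.div_rpow hδ.le (by norm_num), Real.rpow_neg (by norm_num : (0 : ℝ) ≤ 4),
        div_inv_eq_mul]
      ring
    have hS1 : (1 : ℝ) ≤ S.card := by exact_mod_cast hSne.card_pos
    set L := max 0 (Real.logb 2 (c * 4 ^ d * δ ^ (-d))) with hL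
    have hlogL : Real.logb 2 S.card ≤ L := by
      refine le_max_of_le_right (Real.logb_le_logb_of_le (by norm_num) (by linarith) hcard)
    have hlog0 : 0 ≤ Real.logb 2 S.card := Real.logb_nonneg (by norm_num) hS1
    have hL0 : 0 ≤ L := le_max_left _ _
    obtain ⟨G, hG, hG1, hG2⟩ := aux_pairG hp hq0 hX S hSne (η := 2 * δ) (by positivity)
    refine aux_combine hd hp hq hJ hX (ε := δ / 4) (by positivity) hεD S
      (fun t => h2 t (mem_univ t)) hδ le_rfl hL0 G hG hG1 (hG2.trans ?_)
    apply ENNReal.ofReal_le_ofReal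
    calc (2 : ℝ) ^ (p + 1) * S.card * M * (2 * Real.logb 2 S.card * (2 * δ)) ^ q
        ≤ 2 ^ (p + 1) * (c * 4 ^ d * δ ^ (-d)) * M * (2 * L * (2 * δ)) ^ q := by gcongr
      _ = 2 ^ (p + 1) * (c * 4 ^ d * δ ^ (-d)) * M * (2 ^ (2 * q) * L ^ q * δ ^ q) := by
          congr 1
          rw [show 2 * L * (2 * δ) = 2 ^ (2 : ℝ) * L * δ by norm_num; ring,
            Real.mul_rpow (by positivity) hδ.le, Real.mul_rpow (by positivity) hL0,
            ← Real.rpow_mul (by norm_num)]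
      _ = (2 ^ (p + 1) * 2 ^ (2 * q)) * M * c * (δ ^ (-d) * δ ^ q) * (4 ^ d * L ^ q) := by ring
      _ = _ := by
          rw [← Real.rpow_add (by norm_num), ← Real.rpow_add hδ]
          ring_nf
      _ ≤ _ := le_rfl
  · refine aux_combine hd hp hq hJ hX (ε := D.toReal) hDr (ENNReal.ofReal_toReal_le) {x0}
      (fun t => ⟨x0, by simp, by rw [ENNReal.ofReal_toReal hDtop]; exact hle _ _⟩) hδ hcase.le
      (le_max_left _ _) 0 measurable_zero ?_ (by simp)
    intro ω s hs t ht _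
    simp only [Finset.mem_singleton] at hs ht
    simp [hs, ht, hp]
end

section
/- Invariance properties of Brownian motion: Let (B_t)_{t∈ℝ≥0} be a Brownian motion on a probability space (Ω, P). Then: (1) for every c > 0, the process (B_{ct}/√c)_{t∈ℝ≥0} is a Brownian motion; (2) weak Markov property: for every t₀ ∈ ℝ≥0, the process (B_{t₀+t} − B_{t₀})_{t∈ℝ≥0} is a Brownian motion and is independent of the process (B_t)_{t ≤ t₀}; (3) time inversion: the process X defined by X_0 = 0 and X_t = t·B_{1/t} for t > 0 is a Brownian motion; (4) B_t/t converges to 0 almost surely as t → ∞. -/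
open MeasureTheory ProbabilityTheory NNReal Filter

/-- A real-valued stochastic process indexed by `ℝ≥0` is a Brownian motion if almost surely its
paths are continuous, and every finite-dimensional marginal `(X (t 1), …, X (t n))` is a
centered multivariate Gaussian vector with covariance `cov (X (t i), X (t j)) = min (t i) (t j)`,
which is expressed through the one-dimensional laws of all linear combinations: for every
`a : Fin n → ℝ`, the law of `∑ i, a i * X (t i)` is the real Gaussian measure with mean `0` and
variance `∑ i, ∑ j, a i * a j * min (t i) (t j)`. -/
def IsBrownian {Ω : Type*} [MeasurableSpace Ω] (X : ℝ≥0 → Ω → ℝ) (P : Measure Ω) : Prop :=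
  (∀ᵐ ω ∂P, Continuous fun t => X t ω) ∧
  ∀ (n : ℕ) (t : Fin n → ℝ≥0) (a : Fin n → ℝ),
    P.map (fun ω => ∑ i, a i * X (t i) ω) =
      gaussianReal 0 (∑ i, ∑ j, a i * a j * (min (t i) (t j) : ℝ)).toNNReal

lemma IsBrownian.pre {Ω : Type*} [MeasurableSpace Ω]
    {P : Measure Ω} [IsProbabilityMeasure P] {B : ℝ≥0 → Ω → ℝ}
    (hmeas : ∀ t, Measurable (B t)) (hB : IsBrownian B P) : IsPreBrownianReal B P := by
  obtain ⟨-, hB⟩ := hB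
  have hG : IsGaussianProcess B P := by
    refine ⟨fun I => ⟨?_⟩⟩
    have hm : Measurable (fun ω ↦ I.restrict (B · ω)) :=
      measurable_pi_lambda _ fun i => hmeas i
    refine isGaussian_of_isGaussian_map fun L => ?_
    rw [Measure.map_map (by fun_prop) hm]
    let e := I.equivFin
    have : (L ∘ fun ω ↦ I.restrict (B · ω)) =
        fun ω => ∑ i, L (Pi.single (e.symm i) 1) * B (e.symm i) ω := by
      ext ω
      rw [e.symm.sum_comp (fun i => L (Pi.single i 1) * B i ω)]
      simp only [Function.comp]
      conv_lhs => rw [← Finset.univ_sum_single (I.restrict (B · ω))]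
      rw [map_sum]
      refine Finset.sum_congr rfl fun i _ => ?_
      have : (Pi.single i (I.restrict (B · ω) i) : I → ℝ)
          = B i ω • Pi.single i (1:ℝ) := by
        rw [← Pi.single_smul]; simp
      rw [this, map_smul, smul_eq_mul, mul_comm]
    rw [this, hB _ (fun i => (e.symm i : ℝ≥0))]
    infer_instance
  have hvar1 : ∀ t, Var[B t; P] = t := fun t => by
    have h := hB 1 (fun _ => t) (fun _ => 1)
    simp at h
    have h2 := variance_id_gaussianReal (μ := 0) (v := t)
    rw [← h, variance_map (by fun_prop) (by fun_prop)] at h2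
    exact h2
  refine hG.isPreBrownianReal_of_covariance (fun t => ?_) (fun s t hst => ?_)
  · have h := hB 1 (fun _ => t) (fun _ => 1)
    simp at h
    have h2 := integral_id_gaussianReal (μ := 0) (v := t)
    rw [← h, integral_map (by fun_prop) (by fun_prop)] at h2
    exact h2
  · have h := hB 2 ![s, t] (fun _ => 1)
    simp [Fin.sum_univ_two] at h
    rw [min_eq_left (by exact_mod_cast hst), min_eq_right (by exact_mod_cast hst)] at h
    have h2 := variance_id_gaussianReal (μ := 0) (v := ((s:ℝ) + s + (s + t)).toNNReal)
    rw [← h, variance_map (by fun_prop) (by fun_prop), Real.coe_toNNReal _ (by positivity)] at h2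
    have h3 := variance_fun_add (hG.hasGaussianLaw_eval s).memLp_two
      (hG.hasGaussianLaw_eval t).memLp_two
    have h4 : Var[fun ω => B s ω + B t ω; P] = (s:ℝ) + s + (s + t) := h2
    rw [h4, hvar1, hvar1] at h3
    linarith

lemma IsBrownian.of_pre {Ω : Type*} [MeasurableSpace Ω]
    {P : Measure Ω} [IsProbabilityMeasure P] {B : ℝ≥0 → Ω → ℝ}
    (hB : IsPreBrownianReal B P) (hc : ∀ᵐ ω ∂P, Continuous fun t => B t ω) :
    IsBrownian B P := by
  refine ⟨hc, fun n t a => ?_⟩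
  have hG := hB.isGaussianProcess
  have h1 : HasGaussianLaw (fun ω => ∑ i, a i * B (t i) ω) P := by
    let I : Finset ℝ≥0 := Finset.univ.image t
    let L : (I → ℝ) →L[ℝ] ℝ :=
      ∑ i, a i • ContinuousLinearMap.proj (⟨t i, by simp [I]⟩ : I)
    have := (hG.hasGaussianLaw I).map_fun L
    simpa [L] using this
  have hL : ∀ i, MemLp (fun ω => a i * B (t i) ω) 2 P := fun i =>
    (hG.hasGaussianLaw_eval _).memLp_two.const_mul _
  rw [h1.map_eq_gaussianReal, variance_fun_sum hL,
    integral_finsetSum _ fun i _ => (hB.integrable_eval (t i)).const_mul (a i)]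
  congr 2
  · simp [integral_const_mul, hB.integral_eval]
  · refine Finset.sum_congr rfl fun i _ => Finset.sum_congr rfl fun j _ => ?_
    rw [covariance_const_mul_left, covariance_const_mul_right, hB.covariance_fun_eval]
    push_cast; ring

/-- Paths whose restriction to a countable dense set tends to `0` at `0+`. -/
def zeroPaths : Set (ℝ≥0 → ℝ) :=
  ⋂ k : ℕ, ⋃ m : ℕ, ⋂ n : ℕ,
    {f | 0 < TopologicalSpace.denseSeq ℝ≥0 n → TopologicalSpace.denseSeq ℝ≥0 n < 1 / ((m : ℝ≥0) + 1) →
      |f (TopologicalSpace.denseSeq ℝ≥0 n)| ≤ 1 / ((k : ℝ) + 1)}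

lemma measurableSet_zeroPaths : MeasurableSet zeroPaths := by
  refine MeasurableSet.iInter fun k => MeasurableSet.iUnion fun m => MeasurableSet.iInter fun n => ?_
  refine MeasurableSet.imp (.const _) (MeasurableSet.imp (.const _) ?_)
  exact measurableSet_le (by fun_prop) (by fun_prop)

lemma mem_zeroPaths {f : ℝ≥0 → ℝ} (hf : Tendsto f (nhds 0) (nhds 0)) : f ∈ zeroPaths := by
  simp only [zeroPaths, Set.mem_iInter, Set.mem_iUnion, Set.mem_ofPred_eq]
  intro k
  obtain ⟨d, hd, h⟩ := Metric.tendsto_nhds_nhds.1 hf (1 / ((k : ℝ) + 1)) (by positivity)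
  obtain ⟨m, hm⟩ := exists_nat_one_div_lt hd
  refine ⟨m, fun n _ h2 => ?_⟩
  have := h (x := TopologicalSpace.denseSeq ℝ≥0 n) (by
    rw [NNReal.dist_eq]
    have h3 : ((TopologicalSpace.denseSeq ℝ≥0 n : ℝ≥0) : ℝ) < 1 / ((m : ℝ) + 1) := by
      exact_mod_cast h2
    simp
    simp at h3 hm
    linarith)
  simp [Real.dist_eq] at this
  simpa using this.le

lemma tendsto_of_mem_zeroPaths {f : ℝ≥0 → ℝ} (hf : f ∈ zeroPaths) (h0 : f 0 = 0)
    (hc : ContinuousOn f (Set.Ioi 0)) : Tendsto f (nhds 0) (nhds 0) := by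
  simp only [zeroPaths, Set.mem_iInter, Set.mem_iUnion, Set.mem_ofPred_eq] at hf
  rw [Metric.tendsto_nhds]
  intro ε hε
  obtain ⟨k, hk⟩ := exists_nat_one_div_lt hε
  obtain ⟨m, hm⟩ := hf k
  have hpos : (0 : ℝ≥0) < 1 / ((m : ℝ≥0) + 1) := by positivity
  filter_upwards [Iio_mem_nhds hpos] with t ht
  rw [Real.dist_eq, sub_zero]
  rcases eq_or_ne t 0 with rfl | ht0
  · simpa [h0] using hε
  refine lt_of_le_of_lt ?_ hk
  set U : Set ℝ≥0 := Set.Ioo 0 (1 / ((m : ℝ≥0) + 1)) with hU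
  have htU : t ∈ U := ⟨pos_of_ne_zero ht0, ht⟩
  have hcl : t ∈ closure (U ∩ Set.range (TopologicalSpace.denseSeq ℝ≥0)) :=
    (TopologicalSpace.denseRange_denseSeq ℝ≥0).open_subset_closure_inter isOpen_Ioo htU
  have hne := mem_closure_iff_nhdsWithin_neBot.1 hcl
  have hct : Tendsto (fun s => |f s|) (nhdsWithin t (U ∩ Set.range (TopologicalSpace.denseSeq ℝ≥0)))
      (nhds |f t|) := by
    have := (hc t htU.1).abs
    exact this.mono (fun x hx => hx.1.1)
  refine le_of_tendsto hct ?_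
  filter_upwards [self_mem_nhdsWithin] with s hs
  obtain ⟨⟨h1, h2⟩, n, rfl⟩ := hs
  exact hm n h1 h2

/-- **Invariance properties of Brownian motion.** Let `B` be a Brownian motion. Then
(1) for every `c > 0`, `(B (c * t) / √c)` is a Brownian motion;
(2) for every `t₀`, `(B (t₀ + t) - B t₀)` is a Brownian motion independent of `(B t)_{t ≤ t₀}`
(weak Markov property);
(3) the time-inverted process, equal to `0` at `0` and to `t * B (1 / t)` for `t > 0`, is a
Brownian motion;
(4) `B t / t → 0` almost surely as `t → ∞`. -/
theorem isBrownian_invariance {Ω : Type*} [MeasurableSpace Ω]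
    {P : Measure Ω} [IsProbabilityMeasure P] {B : ℝ≥0 → Ω → ℝ}
    (hmeas : ∀ t, Measurable (B t)) (hB : IsBrownian B P) :
    (∀ c : ℝ≥0, 0 < c → IsBrownian (fun t ω => B (c * t) ω / Real.sqrt c) P) ∧
    (∀ t₀ : ℝ≥0,
      IsBrownian (fun t ω => B (t₀ + t) ω - B t₀ ω) P ∧
      Indep
        (⨆ t : ℝ≥0, MeasurableSpace.comap (fun ω => B (t₀ + t) ω - B t₀ ω) inferInstance)
        (⨆ (t : ℝ≥0) (_ : t ≤ t₀), MeasurableSpace.comap (B t) inferInstance) P) ∧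
    (IsBrownian (fun t ω => if t = 0 then 0 else (t : ℝ) * B t⁻¹ ω) P) ∧
    (∀ᵐ ω ∂P, Tendsto (fun t : ℝ≥0 => B t ω / (t : ℝ)) atTop (nhds 0)) := by
  have hp := hB.pre hmeas
  have hcont := hB.1
  have hR : IsBrownianReal B P := ⟨hp, hcont⟩
  set X : ℝ≥0 → Ω → ℝ := fun t ω => if t = 0 then 0 else (t : ℝ) * B t⁻¹ ω with hX
  have hXm : ∀ t, Measurable (X t) := fun t => by
    by_cases ht : t = 0
    · simp [hX, ht]
    · simp only [hX, ht, if_false]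
      exact (hmeas _).const_mul _
  have hXp : IsPreBrownianReal X P := by
    have : X = fun (t : ℝ≥0) ω => (t:ℝ) * B (1 / t) ω := by
      ext t ω
      by_cases ht : t = 0 <;> simp [hX, ht]
    rw [this]
    exact hp.inv
  have hlaw : P.map (fun ω t => B t ω) = P.map (fun ω t => X t ω) :=
    (map_eq_iff_forall_finset_map_restrict_eq
      (measurable_pi_lambda _ hmeas).aemeasurable (measurable_pi_lambda _ hXm).aemeasurable).2
      fun I => (hp.hasLaw I).map_eq.trans (hXp.hasLaw I).map_eq.symm
  have hXz : ∀ᵐ ω ∂P, (fun t => X t ω) ∈ zeroPaths := by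
    have h1 : ∀ᵐ ω ∂P, (fun t => B t ω) ∈ zeroPaths := by
      filter_upwards [hR.tendsto_nhds_zero] with ω h using mem_zeroPaths h
    have h2 := (ae_map_iff (measurable_pi_lambda _ hmeas).aemeasurable
      measurableSet_zeroPaths).2 h1
    rw [hlaw] at h2
    exact (ae_map_iff (measurable_pi_lambda _ hXm).aemeasurable measurableSet_zeroPaths).1 h2
  have hXt : ∀ᵐ ω ∂P, ContinuousOn (fun t => X t ω) (Set.Ioi 0) ∧
      Tendsto (fun t => X t ω) (nhds 0) (nhds 0) := by
    filter_upwards [hXz, hcont] with ω h1 h2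
    have hc : ContinuousOn (fun t => X t ω) (Set.Ioi 0) := by
      have : ContinuousOn (fun t : ℝ≥0 => (t:ℝ) * B t⁻¹ ω) (Set.Ioi 0) := by
        refine NNReal.continuous_coe.continuousOn.mul (h2.comp_continuousOn ?_)
        exact continuousOn_id.inv₀ fun t ht => ht.ne'
      refine this.congr fun t ht => ?_
      have ht' : t ≠ 0 := ne_of_gt (Set.mem_Ioi.1 ht)
      simp [hX, ht']
    exact ⟨hc, tendsto_of_mem_zeroPaths h1 (by simp [hX]) hc⟩
  refine ⟨fun c hc => ?_, fun t₀ => ⟨?_, ?_⟩, ?_, ?_⟩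
  · have := hR.smul hc.ne'
    simp only [div_eq_inv_mul]
    exact .of_pre this.1 this.2
  · exact .of_pre (hR.shift t₀).1 (hR.shift t₀).2
  · have := hp.indepFun_shift t₀
    rw [IndepFun_iff_Indep] at this
    refine indep_of_indep_of_le_left (indep_of_indep_of_le_right this ?_) ?_
    · refine iSup₂_le fun t ht => ?_
      rw [← measurable_iff_comap_le]
      exact (measurable_pi_apply (⟨t, ht⟩ : Set.Iic t₀)).comp
        (comap_measurable (fun ω (t : Set.Iic t₀) ↦ B t ω))
    · refine iSup_le fun t => ?_
      rw [← measurable_iff_comap_le]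
      exact (measurable_pi_apply t).comp
        (comap_measurable (fun ω (t : ℝ≥0) ↦ B (t₀ + t) ω - B t₀ ω))
  · refine .of_pre hXp ?_
    filter_upwards [hXt] with ω ⟨h1, h2⟩
    rw [continuous_iff_continuousAt]
    intro t
    rcases eq_or_ne t 0 with rfl | ht
    · have : X 0 ω = 0 := by simp [hX]
      rw [ContinuousAt, this]
      exact h2
    · exact h1.continuousAt (Ioi_mem_nhds (pos_of_ne_zero ht))
  · filter_upwards [hXt] with ω ⟨_, h2⟩
    have h3 : Tendsto (fun t : ℝ≥0 => t⁻¹) atTop (nhds 0) := tendsto_inv_atTop_zero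
    refine (h2.comp h3).congr' ?_
    filter_upwards [eventually_gt_atTop 0] with t ht
    simp [hX, ht.ne', div_eq_inv_mul]
end
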